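/- arXiv:1306.2390 — 3 statements merged into one kernel-verified Lean document; each statement's English description precedes it below -/
import Mathlib

section
/- Let n ≥ 1 and let Ω ⊆ ℂⁿ be a bounded convex domain. Then Ω is holomorphic homogeneous regular (uniformly squeezing): there exists a constant s > 0 such that for every p ∈ Ω there is an injective holomorphic map f : Ω → 𝔹ⁿ with f(p) = 0 and B(0, s) ⊆ f(Ω); equivalently, the squeezing constant σ̂_Ω = inf_{p∈Ω} σ_Ω(p) is positive. -/
open Metric Set

/-- The squeezing function of a domain `Ω ⊆ ℂⁿ` at a point `p`:
`σ_Ω(p) = sup { r > 0 : ∃ injective holomorphic f : Ω → 𝔹ⁿ with f(p) = 0 and B(0,r) ⊆ f(Ω) }`. -/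
noncomputable def squeezingFun (n : ℕ) (Ω : Set (EuclideanSpace ℂ (Fin n)))
    (p : EuclideanSpace ℂ (Fin n)) : ℝ :=
  sSup { r : ℝ | 0 < r ∧ ∃ f : EuclideanSpace ℂ (Fin n) → EuclideanSpace ℂ (Fin n),
    DifferentiableOn ℂ f Ω ∧ InjOn f Ω ∧ f '' Ω ⊆ ball 0 1 ∧ f p = 0 ∧ ball 0 r ⊆ f '' Ω }

/-- The squeezing constant `σ̂_Ω = inf_{p ∈ Ω} σ_Ω(p)`. -/
noncomputable def squeezingConst (n : ℕ) (Ω : Set (EuclideanSpace ℂ (Fin n))) : ℝ :=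
  sInf (squeezingFun n Ω '' Ω)

open Matrix in
/-- A convex open set containing `p` admits `n` linear functionals (the rows of `M`) with real part
at most `1` on the translate of `Ω` by `-p`, such that the points where all of them have modulus less
than `1 / n` lie in this translate. -/
theorem exists_adapted_matrix {n : ℕ} {Ω : Set (EuclideanSpace ℂ (Fin n))}
    (hopen : IsOpen Ω) (hconv : Convex ℝ Ω) (hbdd : Bornology.IsBounded Ω)
    {p : EuclideanSpace ℂ (Fin n)} (hp : p ∈ Ω) :
    ∃ M : Matrix (Fin n) (Fin n) ℂ, M.det ≠ 0 ∧
      (∀ z ∈ Ω, ∀ j, (∑ k, M j k * (z k - p k)).re ≤ 1) ∧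
      ∀ z : EuclideanSpace ℂ (Fin n),
        (∀ j, n * ‖∑ k, M j k * (z k - p k)‖ < 1) → z ∈ Ω := by
  let S : Set (Matrix (Fin n) (Fin n) ℂ) :=
    {M | ∀ z ∈ Ω, ∀ j, (∑ k, M j k * (z k - p k)).re ≤ 1}
  have hclosed : IsClosed S := by
    simp only [S, Set.ofPred_forall]
    refine isClosed_iInter fun z => isClosed_iInter fun _ => isClosed_iInter fun j => ?_
    refine isClosed_le (Complex.continuous_re.comp ?_) continuous_const
    refine continuous_finsetSum _ fun k _ => ?_
    exact (continuous_id.matrix_elem j k).mul continuous_const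
  obtain ⟨r, hr, hball⟩ := Metric.isOpen_iff.1 hopen p hp
  have hentry : ∀ M ∈ S, ∀ j k, ‖M j k‖ ≤ 2 / r := by
    intro M hM j k
    by_cases h0 : M j k = 0
    · simp only [h0, norm_zero]; positivity
    have hn0 : (0 : ℝ) < ‖M j k‖ := norm_pos_iff.2 h0
    set c : ℂ := ((r / 2 / ‖M j k‖ : ℝ) : ℂ) * (starRingEnd ℂ) (M j k) with hc
    have hcn : ‖c‖ = r / 2 := by
      rw [hc, norm_mul, Complex.norm_real, RCLike.norm_conj, Real.norm_of_nonneg (by positivity)]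
      field_simp
    have hz : p + EuclideanSpace.single k c ∈ Ω := by
      apply hball
      simp only [mem_ball, dist_self_add_left, PiLp.norm_single, hcn]
      linarith
    have := hM _ hz j
    have hsum : ∑ i, M j i * ((p + EuclideanSpace.single k c) i - p i)
        = ((r / 2 * ‖M j k‖ : ℝ) : ℂ) := by
      simp only [PiLp.add_apply, add_sub_cancel_left, PiLp.single_apply, mul_ite,
        mul_zero, Finset.sum_ite_eq', Finset.mem_univ, if_true]
      rw [hc, mul_left_comm, Complex.mul_conj, Complex.normSq_eq_norm_sq, ← Complex.ofReal_mul]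
      congr 1
      field_simp
    rw [hsum, Complex.ofReal_re] at this
    rw [le_div_iff₀ hr]
    linarith
  have hcompact : IsCompact S := by
    refine IsCompact.of_isClosed_subset (isCompact_univ_pi fun _ : Fin n =>
      isCompact_univ_pi fun _ : Fin n => isCompact_closedBall (0 : ℂ) (2 / r)) hclosed ?_
    intro M hM j _ k _
    simpa using hentry M hM j k
  obtain ⟨R, hR, hsub⟩ := hbdd.subset_ball_lt 0 p
  have hR0 : ((R⁻¹ : ℝ) : ℂ) ≠ 0 := by exact_mod_cast (inv_pos.2 hR).ne'
  have hdiag : Matrix.diagonal (fun _ : Fin n => ((R⁻¹ : ℝ) : ℂ)) ∈ S := by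
    intro z hz j
    have h1 : ‖z - p‖ < R := by simpa [dist_eq_norm] using hsub hz
    have h2 : ‖z j - p j‖ ≤ ‖z - p‖ := PiLp.norm_apply_le (z - p) j
    simp only [Matrix.diagonal_apply, ite_mul, zero_mul, Finset.sum_ite_eq, Finset.mem_univ,
      if_true]
    refine (Complex.re_le_norm _).trans ?_
    rw [norm_mul, Complex.norm_real, Real.norm_of_nonneg (by positivity), inv_mul_le_iff₀ hR]
    linarith
  obtain ⟨M, hM, hmax⟩ := hcompact.exists_isMaxOn ⟨_, hdiag⟩
    (f := fun M : Matrix (Fin n) (Fin n) ℂ => ‖M.det‖) (continuous_id.matrix_det.norm.continuousOn)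
  have hdet : M.det ≠ 0 := by
    refine norm_pos_iff.1 (lt_of_lt_of_le ?_ (hmax hdiag))
    simpa [Matrix.det_diagonal, abs_of_pos hR] using pow_pos hR n
  refine ⟨M, hdet, hM, fun z hz => ?_⟩
  by_contra hzΩ
  obtain ⟨f, hf⟩ := RCLike.geometric_hahn_banach_open_point (𝕜 := ℂ) hconv hopen hzΩ
  have hfp : 0 < (f (z - p)).re := by
    have := hf p hp
    simp only [map_sub, Complex.sub_re]
    simpa using this
  set t : ℝ := (f (z - p)).re with ht
  let v : Fin n → ℂ := fun k => ((t⁻¹ : ℝ) : ℂ) * f (EuclideanSpace.single k 1)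
  have hv : ∀ w : EuclideanSpace ℂ (Fin n),
      ∑ k, v k * (w k - p k) = ((t⁻¹ : ℝ) : ℂ) * f (w - p) := by
    intro w
    conv_rhs => rw [← (EuclideanSpace.basisFun (Fin n) ℂ).sum_repr (w - p)]
    simp only [v, map_sum, map_smul, Finset.mul_sum, EuclideanSpace.basisFun_apply,
      EuclideanSpace.basisFun_repr, PiLp.sub_apply, smul_eq_mul]
    exact Finset.sum_congr rfl fun k _ => by ring
  have hvS : ∀ w ∈ Ω, (∑ k, v k * (w k - p k)).re ≤ 1 := by
    intro w hw
    rw [hv, Complex.re_ofReal_mul, inv_mul_le_iff₀ hfp, mul_one, ht, map_sub, map_sub,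
      Complex.sub_re, Complex.sub_re]
    have : (f w).re < (f z).re := hf w hw
    linarith
  let c : Fin n → ℂ := v ᵥ* M⁻¹
  have hcv : v = ∑ k, c k • M k := by
    rw [← Matrix.vecMul_eq_sum, Matrix.vecMul_vecMul, Matrix.nonsing_inv_mul _ hdet.isUnit,
      Matrix.vecMul_one]
  have hc : ∀ j, ‖c j‖ ≤ 1 := by
    intro j
    have hup : M.updateRow j v ∈ S := by
      intro w hw i
      by_cases hij : i = j
      · subst hij; simpa using hvS w hw
      · simpa [Matrix.updateRow_ne hij] using hM w hw i
    have h1 : ‖(M.updateRow j v).det‖ ≤ ‖M.det‖ := hmax hup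
    rw [hcv, Matrix.det_updateRow_sum, norm_smul] at h1
    exact le_of_mul_le_mul_right (by simpa using h1) (norm_pos_iff.2 hdet)
  have hone : (∑ k, v k * (z k - p k)).re = 1 := by
    rw [hv, Complex.re_ofReal_mul, ← ht, inv_mul_cancel₀ hfp.ne']
  have hexp : ∑ k, v k * (z k - p k) = ∑ j, c j * ∑ k, M j k * (z k - p k) := by
    simp only [hcv, Finset.sum_apply, Pi.smul_apply, smul_eq_mul, Finset.sum_mul, Finset.mul_sum]
    rw [Finset.sum_comm]
    simp only [mul_assoc]
  have hn : 0 < n := by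
    rcases Nat.eq_zero_or_pos n with rfl | h
    · simp at hone
    · exact h
  have hnR : (0 : ℝ) < n := by exact_mod_cast hn
  have : (∑ k, v k * (z k - p k)).re < 1 := by
    rw [hexp]
    calc _ ≤ ‖∑ j, c j * ∑ k, M j k * (z k - p k)‖ := Complex.re_le_norm _
      _ ≤ ∑ j, ‖c j * ∑ k, M j k * (z k - p k)‖ := norm_sum_le _ _
      _ < ∑ _j : Fin n, (1 / n : ℝ) := by
        refine Finset.sum_lt_sum_of_nonempty ⟨⟨0, hn⟩, Finset.mem_univ _⟩ fun j _ => ?_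
        rw [norm_mul, lt_div_iff₀ hnR]
        have h1 := hz j
        have h2 := mul_le_mul_of_nonneg_right (hc j) (norm_nonneg (∑ k, M j k * (z k - p k)))
        nlinarith
      _ = 1 := by
        simp [hnR.ne']
  linarith

/-- The Möbius map `a ↦ a / (4 - a)` sends the half-plane `re a ≤ 1` into the unit disc. -/
theorem norm_div_four_sub_lt_one {a : ℂ} (ha : a.re ≤ 1) : ‖a / (4 - a)‖ < 1 := by
  have h4 : 4 - a ≠ 0 := by
    intro h
    have := congrArg Complex.re h
    simp at this
    linarith
  rw [norm_div, div_lt_one (norm_pos_iff.2 h4)]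
  refine lt_of_pow_lt_pow_left₀ 2 (norm_nonneg _) ?_
  rw [← Complex.normSq_eq_norm_sq, ← Complex.normSq_eq_norm_sq, Complex.normSq_apply,
    Complex.normSq_apply]
  simp
  nlinarith

open Matrix in
/-- The squeezing function of a bounded convex domain in `ℂⁿ` is at least `1 / (8 n²)`. -/
theorem exists_squeezing_map {n : ℕ} (hn : 1 ≤ n) {Ω : Set (EuclideanSpace ℂ (Fin n))}
    (hopen : IsOpen Ω) (hconv : Convex ℝ Ω) (hbdd : Bornology.IsBounded Ω)
    {p : EuclideanSpace ℂ (Fin n)} (hp : p ∈ Ω) :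
    ∃ f : EuclideanSpace ℂ (Fin n) → EuclideanSpace ℂ (Fin n),
      DifferentiableOn ℂ f Ω ∧ InjOn f Ω ∧ f '' Ω ⊆ ball 0 1 ∧ f p = 0 ∧
      ball 0 (1 / (8 * (n : ℝ) ^ 2)) ⊆ f '' Ω := by
  obtain ⟨M, hdet, hM, hin⟩ := exists_adapted_matrix hopen hconv hbdd hp
  have hn1 : (1 : ℝ) ≤ n := by exact_mod_cast hn
  have hnR : (0 : ℝ) < n := by linarith
  have hnC : (n : ℂ) ≠ 0 := by exact_mod_cast hnR.ne'
  let L : Fin n → EuclideanSpace ℂ (Fin n) → ℂ := fun j z => ∑ k, M j k * (z k - p k)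
  have hL4 : ∀ z ∈ Ω, ∀ j, 4 - L j z ≠ 0 := by
    intro z hz j h
    have h1 : (L j z).re ≤ 1 := hM z hz j
    have := congrArg Complex.re h
    simp at this
    linarith
  refine ⟨fun z => WithLp.toLp 2 fun j => L j z / (4 - L j z) / n, ?_, ?_, ?_, ?_, ?_⟩
  · rw [differentiableOn_euclidean]
    intro j
    have hL : Differentiable ℂ (L j) := by
      simp only [L]
      fun_prop
    simp only [div_eq_mul_inv]
    exact (hL.differentiableOn.mul ((hL.differentiableOn.const_sub 4).inv
      fun z hz => hL4 z hz j)).mul_const _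
  · intro z hz w hw hzw
    have hLe : ∀ j, L j z = L j w := by
      intro j
      have h := congrArg (fun u : EuclideanSpace ℂ (Fin n) => u j) hzw
      simp only at h
      rw [div_left_inj' hnC, div_eq_div_iff (hL4 z hz j) (hL4 w hw j)] at h
      linear_combination h / 4
    have hinj := Matrix.mulVec_injective_of_isUnit ((Matrix.isUnit_iff_isUnit_det M).2 hdet.isUnit)
    have : (fun k => z k - p k) = fun k => w k - p k := hinj (funext hLe)
    ext k
    simpa using congrFun this k
  · rintro _ ⟨z, hz, rfl⟩
    rw [mem_ball_zero_iff, EuclideanSpace.norm_eq, Real.sqrt_lt' one_pos, one_pow]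
    calc _ < ∑ _j : Fin n, (1 / n : ℝ) := by
          refine Finset.sum_lt_sum_of_nonempty ⟨⟨0, hn⟩, Finset.mem_univ _⟩ fun j _ => ?_
          have h1 : ‖L j z / (4 - L j z)‖ < 1 := norm_div_four_sub_lt_one (hM z hz j)
          have h0 := norm_nonneg (L j z / (4 - L j z))
          simp only
          rw [norm_div, Complex.norm_natCast, div_pow, div_lt_div_iff₀ (by positivity) hnR]
          have h2 : ‖L j z / (4 - L j z)‖ ^ 2 < 1 := by nlinarith
          nlinarith
      _ = 1 := by simp [hnR.ne']
  · ext j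
    simp [L]
  · intro y hy
    rw [mem_ball_zero_iff] at hy
    let η : Fin n → ℂ := fun j => n * y j
    have hη : ∀ j, n * ‖η j‖ < 1 / 8 := by
      intro j
      have h1 : ‖y j‖ < 1 / (8 * (n : ℝ) ^ 2) := (PiLp.norm_apply_le y j).trans_lt hy
      rw [lt_div_iff₀ (by positivity)] at h1
      simp only [η, norm_mul, Complex.norm_natCast]
      nlinarith
    have hη8 : ∀ j, ‖η j‖ < 1 / 8 := fun j =>
      lt_of_le_of_lt (by nlinarith [norm_nonneg (η j)]) (hη j)
    have hη1n : ∀ j, 7 / 8 < ‖1 + η j‖ := by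
      intro j
      have := norm_sub_norm_le (1 : ℂ) (-η j)
      rw [norm_neg, norm_one, sub_neg_eq_add] at this
      linarith [hη8 j]
    have hη1 : ∀ j, 1 + η j ≠ 0 := fun j =>
      norm_pos_iff.1 (lt_trans (by norm_num) (hη1n j))
    let ζ : Fin n → ℂ := fun j => 4 * η j / (1 + η j)
    let z : EuclideanSpace ℂ (Fin n) := p + WithLp.toLp 2 (M⁻¹ *ᵥ ζ)
    have hLz : ∀ j, L j z = ζ j := by
      intro j
      have h : M *ᵥ (M⁻¹ *ᵥ ζ) = ζ := by
        rw [Matrix.mulVec_mulVec, Matrix.mul_nonsing_inv _ hdet.isUnit, Matrix.one_mulVec]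
      rw [← congrFun h j]
      simp [L, z, Matrix.mulVec, dotProduct]
    refine ⟨z, hin z fun j => ?_, ?_⟩
    · change n * ‖L j z‖ < 1
      rw [hLz, norm_div, norm_mul, ← mul_div_assoc,
        div_lt_one (lt_trans (by norm_num) (hη1n j))]
      norm_num
      linarith [hη j, hη1n j]
    · ext j
      simp only [hLz, ζ]
      have h := hη1 j
      have h4 : 4 - 4 * η j / (1 + η j) = 4 / (1 + η j) := by field_simp; ring
      rw [h4]
      field_simp
      simp [η]

/-- Every bounded convex domain in `ℂⁿ` (`n ≥ 1`) is holomorphic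
homogeneous regular (uniformly squeezing). -/
theorem bounded_convex_domain_HHR (n : ℕ) (hn : 1 ≤ n)
    (Ω : Set (EuclideanSpace ℂ (Fin n)))
    (hopen : IsOpen Ω) (hconn : IsConnected Ω) (hconv : Convex ℝ Ω)
    (hbdd : Bornology.IsBounded Ω) :
    (∃ s > (0 : ℝ), ∀ p ∈ Ω,
      ∃ f : EuclideanSpace ℂ (Fin n) → EuclideanSpace ℂ (Fin n),
        DifferentiableOn ℂ f Ω ∧ InjOn f Ω ∧ f '' Ω ⊆ ball 0 1 ∧ f p = 0 ∧
        ball 0 s ⊆ f '' Ω) ∧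
    0 < squeezingConst n Ω := by
  have hs : (0 : ℝ) < 1 / (8 * (n : ℝ) ^ 2) := by
    have : (0 : ℝ) < n := by exact_mod_cast hn
    positivity
  refine ⟨⟨_, hs, fun p hp => exists_squeezing_map hn hopen hconv hbdd hp⟩, hs.trans_le ?_⟩
  refine le_csInf (hconn.nonempty.image _) ?_
  rintro _ ⟨p, hp, rfl⟩
  refine le_csSup ⟨1, ?_⟩ ⟨hs, exists_squeezing_map hn hopen hconv hbdd hp⟩
  rintro r ⟨_, f, _, _, hf, _, hr⟩
  by_contra! h
  have hmem : EuclideanSpace.single (⟨0, hn⟩ : Fin n) (1 : ℂ) ∈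
      ball (0 : EuclideanSpace ℂ (Fin n)) r := by
    simpa using h
  simpa using hf (hr hmem)
end

section
/- Let n ≥ 1 and let Ω ⊆ ℂⁿ be a convex domain that contains no complex affine line, i.e., there are no a ∈ ℂⁿ and b ∈ ℂⁿ \ {0} with { a + ζ·b : ζ ∈ ℂ } ⊆ Ω (for convex domains this is equivalent to Kobayashi hyperbolicity). Then Ω is holomorphic homogeneous regular: there exists s > 0 such that for every p ∈ Ω there is an injective holomorphic map f : Ω → 𝔹ⁿ with f(p) = 0 and B(0, s) ⊆ f(Ω). -/
open Metric Set

open scoped InnerProductSpace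

/-- **Auerbach's lemma** for a compact spanning set: it contains a basis for which every point of
the set has coordinates of modulus at most one. -/
theorem IsCompact.exists_basis_norm_repr_le_one {ι E : Type*} [Fintype ι] [NormedAddCommGroup E]
    [NormedSpace ℂ E] (e : Module.Basis ι ℂ E) {S : Set E} (hS : IsCompact S)
    (hspan : Submodule.span ℂ S = ⊤) :
    ∃ b : Module.Basis ι ℂ E, (∀ i, b i ∈ S) ∧ ∀ u ∈ S, ∀ i, ‖b.repr u i‖ ≤ 1 := by
  classical
  have : FiniteDimensional ℂ E := e.finiteDimensional_of_finite
  have hcont : Continuous fun v : ι → E => ‖e.det v‖ := by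
    simp only [Module.Basis.det_apply]
    refine (Continuous.matrix_det ?_).norm
    refine continuous_matrix fun i j => ?_
    exact (e.coord i).continuous_of_finiteDimensional.comp (continuous_apply j)
  obtain ⟨t, htS, htspan, htli⟩ := exists_linearIndependent ℂ S
  have bt : Module.Basis t ℂ E := Module.Basis.mk htli (by simp [htspan, hspan])
  obtain ⟨c, hcS, hcli, hcspan⟩ : ∃ c : ι → E, (∀ i, c i ∈ S) ∧ LinearIndependent ℂ c ∧
      Submodule.span ℂ (Set.range c) = ⊤ := by
    let eq : ι ≃ t := e.indexEquiv bt
    refine ⟨fun i => (eq i : E), fun i => htS (eq i).2, htli.comp eq eq.injective, ?_⟩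
    have : Set.range (fun i => (eq i : E)) = t := by
      rw [show (fun i => (eq i : E)) = Subtype.val ∘ eq from rfl, eq.surjective.range_comp]
      simp
    rw [this, htspan, hspan]
  obtain ⟨v, hv, hmax⟩ := (isCompact_univ_pi fun _ : ι => hS).exists_isMaxOn
    ⟨c, fun i _ => hcS i⟩ hcont.continuousOn
  have hc : 0 < ‖e.det c‖ :=
    norm_pos_iff.2 ((Module.Basis.is_basis_iff_det e).1 ⟨hcli, hcspan⟩).ne_zero
  have hvpos : 0 < ‖e.det v‖ := hc.trans_le (hmax fun i _ => hcS i)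
  obtain ⟨hvli, hvspan⟩ := (Module.Basis.is_basis_iff_det e).2 (norm_pos_iff.1 hvpos).isUnit
  let b := Module.Basis.mk hvli hvspan.ge
  have hb : ⇑b = v := Module.Basis.coe_mk _ _
  refine ⟨b, fun i => by rw [hb]; exact hv i trivial, fun u hu i => ?_⟩
  have hu' : ‖e.det (Function.update v i u)‖ ≤ ‖e.det v‖ := by
    refine hmax fun j _ => ?_
    rcases eq_or_ne j i with rfl | h
    · simpa using hu
    · simpa [h] using hv j trivial
  have hdet : e.det (Function.update v i u) = b.repr u i * e.det v := by
    conv_lhs => rw [← b.sum_repr u, hb]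
    rw [AlternatingMap.map_update_sum, Finset.sum_eq_single i]
    · simp
    · intro j _ hj
      rw [AlternatingMap.map_update_smul, AlternatingMap.map_update_self _ _ hj.symm, smul_zero]
    · simp
  rw [hdet, norm_mul] at hu'
  exact le_of_mul_le_mul_right (by simpa using hu') hvpos

section Polar

variable {E : Type*} [NormedAddCommGroup E] [InnerProductSpace ℂ E]

/-- The (one-sided, real) polar of `Ω` with respect to the base point `p`. -/
def polarAt (Ω : Set E) (p : E) : Set E :=
  {v | ∀ y ∈ Ω, (⟪v, y - p⟫_ℂ).re ≤ 1}

theorem isClosed_polarAt (Ω : Set E) (p : E) : IsClosed (polarAt Ω p) := by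
  simp only [polarAt, ofPred_forall]
  refine isClosed_biInter fun y _ => isClosed_le ?_ continuous_const
  exact Complex.continuous_re.comp (continuous_id.inner continuous_const)

theorem isCompact_polarAt [FiniteDimensional ℂ E] {Ω : Set E} (hΩ : IsOpen Ω) {p : E}
    (hp : p ∈ Ω) : IsCompact (polarAt Ω p) := by
  have : ProperSpace E := FiniteDimensional.proper ℂ E
  obtain ⟨r, hr, hball⟩ := Metric.isOpen_iff.1 hΩ p hp
  refine Metric.isCompact_of_isClosed_isBounded (isClosed_polarAt Ω p) ?_
  refine (Metric.isBounded_closedBall (x := (0 : E)) (r := 2 / r)).subset fun v hv => ?_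
  rw [mem_closedBall_zero_iff, le_div_iff₀ hr]
  rcases eq_or_ne v 0 with rfl | hv0
  · simp
  have hvpos : 0 < ‖v‖ := norm_pos_iff.2 hv0
  let c : ℝ := r / 2 / ‖v‖
  have hc : 0 < c := by positivity
  have hy : p + (c : ℂ) • v ∈ Ω := by
    refine hball ?_
    rw [mem_ball_iff_norm, add_sub_cancel_left, norm_smul, Complex.norm_real, Real.norm_eq_abs,
      abs_of_pos hc, div_mul_cancel₀ _ hvpos.ne']
    linarith
  have h := hv _ hy
  rw [add_sub_cancel_left, inner_smul_right, Complex.re_ofReal_mul,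
    show (⟪v, v⟫_ℂ).re = ‖v‖ ^ 2 from inner_self_eq_norm_sq (𝕜 := ℂ) v] at h
  have : c * ‖v‖ ^ 2 = ‖v‖ * r / 2 := by
    simp only [c]
    field_simp
  linarith

/-- **Bipolar theorem** for an open convex set. -/
theorem mem_of_forall_polarAt_re_lt_one [CompleteSpace E] {Ω : Set E} (hΩ : IsOpen Ω)
    (hconv : Convex ℝ Ω) {p x : E} (hp : p ∈ Ω)
    (hx : ∀ v ∈ polarAt Ω p, (⟪v, x - p⟫_ℂ).re < 1) : x ∈ Ω := by
  by_contra hxΩ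
  obtain ⟨f, hf⟩ := RCLike.geometric_hahn_banach_open_point (𝕜 := ℂ) hconv hΩ hxΩ
  have hpos : 0 < (f (x - p)).re := by
    have := hf p hp
    simp only [RCLike.re_to_complex] at this
    simpa using this
  set a := (f (x - p)).re with ha
  let v : E := (a⁻¹ : ℂ) • (InnerProductSpace.toDual ℂ E).symm f
  have hv (y : E) : (⟪v, y⟫_ℂ).re = a⁻¹ * (f y).re := by
    simp only [v, inner_smul_left, InnerProductSpace.toDual_symm_apply]
    rw [← Complex.ofReal_inv, Complex.conj_ofReal, Complex.re_ofReal_mul]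
  have hmem : v ∈ polarAt Ω p := by
    intro y hy
    rw [hv, inv_mul_le_iff₀ hpos, mul_one, ha]
    have := hf y hy
    simp only [RCLike.re_to_complex] at this
    simpa using this.le
  have := hx v hmem
  rw [hv, ← ha, inv_mul_cancel₀ hpos.ne'] at this
  exact lt_irrefl _ this

theorem span_polarAt_eq_top [FiniteDimensional ℂ E] {Ω : Set E} (hΩ : IsOpen Ω)
    (hconv : Convex ℝ Ω)
    (hline : ¬ ∃ a b : E, b ≠ 0 ∧ (Set.range fun ζ : ℂ => a + ζ • b) ⊆ Ω) {p : E} (hp : p ∈ Ω) :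
    Submodule.span ℂ (polarAt Ω p) = ⊤ := by
  have : CompleteSpace E := FiniteDimensional.complete ℂ E
  by_contra h
  have hperp : (Submodule.span ℂ (polarAt Ω p))ᗮ ≠ ⊥ := fun h' =>
    h (Submodule.orthogonal_eq_bot_iff.1 h')
  obtain ⟨b, hb, hb0⟩ := Submodule.exists_mem_ne_zero_of_ne_bot hperp
  refine hline ⟨p, b, hb0, ?_⟩
  rintro _ ⟨ζ, rfl⟩
  refine mem_of_forall_polarAt_re_lt_one hΩ hconv hp fun v hv => ?_
  have : ⟪v, b⟫_ℂ = 0 := (Submodule.mem_orthogonal _ _).1 hb v (Submodule.subset_span hv)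
  simp [this]

end Polar

theorem four_sub_ne_zero_of_re_le_one {w : ℂ} (hw : w.re ≤ 1) : 4 - w ≠ 0 := by
  intro h
  have := congrArg Complex.re h
  simp at this
  linarith

/-- The Cayley transform `w ↦ w / (4 - w)` maps `{Re w ≤ 1}` into the unit disc. -/
theorem norm_div_four_sub_lt_one_s1 {w : ℂ} (hw : w.re ≤ 1) : ‖w / (4 - w)‖ < 1 := by
  rw [norm_div, div_lt_one (norm_pos_iff.2 (four_sub_ne_zero_of_re_le_one hw))]
  refine lt_of_pow_lt_pow_left₀ 2 (norm_nonneg _) ?_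
  rw [Complex.sq_norm, Complex.sq_norm, Complex.normSq_apply, Complex.normSq_apply]
  simp
  nlinarith

theorem convex_hyperbolic_domain_HHR (n : ℕ) (hn : 1 ≤ n)
    (Ω : Set (EuclideanSpace ℂ (Fin n)))
    (hopen : IsOpen Ω) (hconn : IsConnected Ω) (hconv : Convex ℝ Ω)
    (hline : ¬ ∃ (a b : EuclideanSpace ℂ (Fin n)), b ≠ 0 ∧
      (Set.range fun ζ : ℂ => a + ζ • b) ⊆ Ω) :
    ∃ s > (0 : ℝ), ∀ p ∈ Ω,
      ∃ f : EuclideanSpace ℂ (Fin n) → EuclideanSpace ℂ (Fin n),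
        DifferentiableOn ℂ f Ω ∧ InjOn f Ω ∧ f '' Ω ⊆ ball 0 1 ∧ f p = 0 ∧
        ball 0 s ⊆ f '' Ω := by
  have hn1 : (1 : ℝ) ≤ n := by exact_mod_cast hn
  have hn0 : (0 : ℝ) < n := by linarith
  have hnC : (n : ℂ) ≠ 0 := by exact_mod_cast hn0.ne'
  refine ⟨1 / (8 * n ^ 2), by positivity, fun p hp => ?_⟩
  obtain ⟨b, hbS, hb⟩ := (isCompact_polarAt hopen hp).exists_basis_norm_repr_le_one
    (EuclideanSpace.basisFun (Fin n) ℂ).toBasis (span_polarAt_eq_top hopen hconv hline hp)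
  have hre (x) (hx : x ∈ Ω) (j) : (⟪b j, x - p⟫_ℂ).re ≤ 1 := hbS j x hx
  have hne (x) (hx : x ∈ Ω) (j) : 4 - ⟪b j, x - p⟫_ℂ ≠ 0 :=
    four_sub_ne_zero_of_re_le_one (hre x hx j)
  refine ⟨fun x => WithLp.toLp 2 fun j => (n : ℂ)⁻¹ * (⟪b j, x - p⟫_ℂ / (4 - ⟪b j, x - p⟫_ℂ)),
    ?_, ?_, ?_, ?_, ?_⟩
  · rw [differentiableOn_euclidean]
    intro j
    have hd : Differentiable ℂ fun x => ⟪b j, x - p⟫_ℂ :=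
      (innerSL ℂ (b j)).differentiable.comp (differentiable_id.sub_const p)
    simp only [div_eq_mul_inv]
    exact (hd.differentiableOn.mul ((hd.differentiableOn.const_sub 4).inv
      fun x hx => hne x hx j)).const_mul _
  · intro x hx y hy hxy
    have hij (j) : ⟪b j, x - p⟫_ℂ = ⟪b j, y - p⟫_ℂ := by
      have h := congrArg (fun z : EuclideanSpace ℂ (Fin n) => z j) hxy
      simp only at h
      have h := mul_left_cancel₀ (inv_ne_zero hnC) h
      rw [div_eq_div_iff (hne x hx j) (hne y hy j)] at h
      linear_combination h / 4
    exact sub_left_injective (InnerProductSpace.ext_inner_left_basis b hij)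
  · rintro _ ⟨x, hx, rfl⟩
    rw [mem_ball_zero_iff]
    refine lt_of_pow_lt_pow_left₀ 2 zero_le_one ?_
    rw [EuclideanSpace.norm_sq_eq]
    have hlt (j : Fin n) :
        ‖(n : ℂ)⁻¹ * (⟪b j, x - p⟫_ℂ / (4 - ⟪b j, x - p⟫_ℂ))‖ ^ 2 < (n : ℝ)⁻¹ := by
      rw [norm_mul, norm_inv, Complex.norm_natCast, mul_pow]
      have h1 := norm_div_four_sub_lt_one_s1 (hre x hx j)
      have h2 : ‖⟪b j, x - p⟫_ℂ / (4 - ⟪b j, x - p⟫_ℂ)‖ ^ 2 < 1 :=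
        pow_lt_one₀ (norm_nonneg _) h1 two_ne_zero
      have h3 : ((n : ℝ)⁻¹) ^ 2 ≤ (n : ℝ)⁻¹ :=
        pow_le_of_le_one (by positivity) (inv_le_one_of_one_le₀ hn1) two_ne_zero
      have h4 : 0 < ((n : ℝ)⁻¹) ^ 2 := by positivity
      nlinarith
    have hnonempty : (Finset.univ : Finset (Fin n)).Nonempty := ⟨⟨0, hn⟩, Finset.mem_univ _⟩
    calc _ < ∑ _j : Fin n, (n : ℝ)⁻¹ := Finset.sum_lt_sum_of_nonempty hnonempty fun j _ => hlt j
      _ = 1 ^ 2 := by simp [hn0.ne']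
  · ext j
    simp
  · intro y hy
    have hyj (j : Fin n) : ‖n * y j‖ < 1 / (8 * n) := by
      rw [mem_ball_zero_iff] at hy
      have := (PiLp.norm_apply_le y j).trans_lt hy
      rw [norm_mul, Complex.norm_natCast]
      calc (n : ℝ) * ‖y j‖ < n * (1 / (8 * n ^ 2)) := by gcongr
        _ = 1 / (8 * n) := by field_simp
    have hle : 1 / (8 * (n : ℝ)) ≤ 1 / 8 :=
      one_div_le_one_div_of_le (by norm_num) (by linarith)
    have hden (j : Fin n) : 7 / 8 ≤ ‖1 + n * y j‖ := by
      have h := norm_sub_le (1 + n * y j) (n * y j)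
      rw [add_sub_cancel_right, norm_one] at h
      linarith [hyj j]
    have hden0 (j : Fin n) : 1 + n * y j ≠ 0 := by
      rw [← norm_pos_iff]
      linarith [hden j]
    let T : EuclideanSpace ℂ (Fin n) →ₗ[ℂ] (Fin n → ℂ) :=
      LinearMap.pi fun j => (innerSL ℂ (b j)).toLinearMap
    have hTinj : Function.Injective T := fun x x' h =>
      InnerProductSpace.ext_inner_left_basis b fun j => congrFun h j
    obtain ⟨z, hz⟩ := (LinearMap.injective_iff_surjective_of_finrank_eq_finrank (by simp)).1 hTinj
      fun j => 4 * (n * y j) / (1 + n * y j)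
    have hzj (j) : ⟪b j, z⟫_ℂ = 4 * (n * y j) / (1 + n * y j) := congrFun hz j
    have hznorm (j) : ‖⟪b j, z⟫_ℂ‖ < (n : ℝ)⁻¹ := by
      rw [hzj, norm_div, norm_mul, div_lt_iff₀ (by linarith [hden j])]
      have h1 : ‖(4 : ℂ)‖ = 4 := by simp
      have h2 : (n : ℝ)⁻¹ * (7 / 8) ≤ (n : ℝ)⁻¹ * ‖1 + n * y j‖ := by
        gcongr
        exact hden j
      have h3 : 1 / (8 * (n : ℝ)) = (n : ℝ)⁻¹ / 8 := by field_simp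
      have h4 : 0 < (n : ℝ)⁻¹ := by positivity
      rw [h1]
      linarith [hyj j]
    refine ⟨p + z, ?_, ?_⟩
    · refine mem_of_forall_polarAt_re_lt_one hopen hconv hp fun v hv => ?_
      rw [add_sub_cancel_left, ← b.sum_repr v, sum_inner]
      have hnonempty : (Finset.univ : Finset (Fin n)).Nonempty := ⟨⟨0, hn⟩, Finset.mem_univ _⟩
      refine (Complex.re_le_norm _).trans_lt ((norm_sum_le _ _).trans_lt ?_)
      calc _ < ∑ _j : Fin n, (n : ℝ)⁻¹ := Finset.sum_lt_sum_of_nonempty hnonempty fun j _ => by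
            rw [inner_smul_left, norm_mul, RCLike.norm_conj]
            exact (mul_le_of_le_one_left (norm_nonneg _) (hb v hv j)).trans_lt (hznorm j)
        _ = 1 := by simp [hn0.ne']
    · ext j
      simp only [add_sub_cancel_left, hzj]
      have h := hden0 j
      have h4 : 4 - 4 * (n * y j) / (1 + n * y j) = 4 / (1 + n * y j) := by
        field_simp
        ring
      rw [h4]
      field_simp
end

section
/- Let Ω ⊆ ℂⁿ be a bounded domain with C² strongly convex boundary: there is a function ρ : ℂⁿ → ℝ of class C² with Ω = {ρ < 0}, ∂Ω = {ρ = 0}, the (real) gradient of ρ nonvanishing on ∂Ω, and the real Hessian D²ρ(x) positive definite at every x ∈ ∂Ω. Then for every p ∈ ∂Ω, the squeezing function satisfies lim_{Ω ∋ q → p} σ_Ω(q) = 1; i.e., for every ε > 0 there is r > 0 such that σ_Ω(q) > 1 − ε for all q ∈ Ω ∩ B(p, r). -/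
open Metric Set

lemma cayley_norm_sq {δ : ℝ} (t : ℝ) {ξ : ℂ} (hξ : ξ - δ ≠ 0) :
    ‖(ξ + δ) / (ξ - δ)‖ ^ 2 + 4 * δ * t / ‖ξ - δ‖ ^ 2
      = 1 + 4 * δ * (ξ.re + t) / ‖ξ - δ‖ ^ 2 := by
  have h : ‖ξ - δ‖ ^ 2 ≠ 0 := by positivity
  have h2 : ‖ξ + δ‖ ^ 2 = ‖ξ - δ‖ ^ 2 + 4 * δ * ξ.re := by
    simp only [Complex.sq_norm, Complex.normSq_apply, Complex.add_re, Complex.sub_re,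
      Complex.add_im, Complex.sub_im, Complex.ofReal_re, Complex.ofReal_im]
    ring
  rw [norm_div, div_pow, h2]
  field_simp
  ring

lemma mul_norm_le_norm_sub_sq {δ : ℝ} {ξ : ℂ} (hδ : 0 < δ) (h : ξ.re ≤ ‖ξ‖ / 2) :
    δ * ‖ξ‖ ≤ ‖ξ - δ‖ ^ 2 ∧ ξ - δ ≠ 0 := by
  have h2 : ‖ξ - δ‖ ^ 2 = ‖ξ‖ ^ 2 + δ ^ 2 - 2 * δ * ξ.re := by
    simp only [Complex.sq_norm, Complex.normSq_apply, Complex.sub_re, Complex.sub_im,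
      Complex.ofReal_re, Complex.ofReal_im]
    ring
  have h3 : δ * ξ.re ≤ δ * (‖ξ‖ / 2) := by gcongr
  refine ⟨by nlinarith [sq_nonneg (‖ξ‖ - δ)], fun h0 => ?_⟩
  rw [h0] at h2
  simp only [norm_zero] at h2
  nlinarith [sq_nonneg (‖ξ‖ - δ / 2), sq_pos_of_pos hδ]

/-- The cut-off factor `(1 - N x)⁻¹` on the closed left half-plane. -/
lemma cutoff_bounds {N : ℝ} (hN : 0 < N) {x : ℂ} (hx : x.re ≤ 0) :
    0 < (1 - N * x).re ∧ ‖(1 - N * x)⁻¹‖ ≤ 1 ∧ ‖(1 - N * x)⁻¹ - 1‖ ≤ 1 ∧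
      ‖(1 - N * x)⁻¹ - 1‖ ≤ N * ‖x‖ ∧ ‖(1 - N * x)⁻¹‖ * (N * ‖x‖) ≤ 1 := by
  have h0 : (1 - N * x).re = 1 - N * x.re := by simp
  have hre : 1 ≤ (1 - N * x).re := by rw [h0]; nlinarith
  have h1 : 1 ≤ ‖1 - N * x‖ := hre.trans (Complex.re_le_norm _)
  have hne : (1 - N * x) ≠ 0 := by
    intro h; rw [h] at h1; simp at h1; linarith
  have hpos : 0 < ‖1 - N * x‖ := by linarith
  have hNx : ‖(N : ℂ) * x‖ = N * ‖x‖ := by simp [abs_of_pos hN]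
  have h2 : N * ‖x‖ ≤ ‖1 - N * x‖ := by
    rw [← hNx]
    refine le_of_sq_le_sq ?_ (norm_nonneg _) 
    simp only [Complex.sq_norm, Complex.normSq_apply, Complex.sub_re, Complex.sub_im, 
      Complex.one_re, Complex.one_im, Complex.re_ofReal_mul, Complex.im_ofReal_mul]
    nlinarith
  have h3 : (1 - N * x)⁻¹ - 1 = (1 - N * x)⁻¹ * (N * x) := by
    field_simp; ring
  have h4 : ‖(1 - N * x)⁻¹‖ ≤ 1 := by rw [norm_inv]; exact inv_le_one_of_one_le₀ h1
  have h5 : ‖(1 - N * x)⁻¹‖ * (N * ‖x‖) ≤ 1 := by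
    rw [norm_inv, inv_mul_le_iff₀ hpos]; linarith
  refine ⟨by linarith, h4, ?_, ?_, h5⟩
  · rw [h3, norm_mul, hNx]; exact h5
  · rw [h3, norm_mul, hNx]
    exact mul_le_of_le_one_left (by positivity) h4

lemma sheared_height_bounds {x g α : ℂ} {t a η c E : ℝ} (ht : 0 ≤ t) (hα : ‖α‖ ≤ a * t)
    (ha : a ≤ 1) (hc : 0 < c) (hc1 : c ≤ 1) (hac : a + η + c ≤ 1)
    (hg : ‖g - 1‖ ≤ 1) (hg' : ‖g‖ ≤ 1) (h : x.re + α.re + t ≤ η * t + E) (hE : E ≤ c / 4 * ‖x‖) :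
    (x + g * α).re ≤ ‖x + g * α‖ / 2 ∧ c * t ≤ 3 * ‖x + g * α‖ ∧
      c * ‖x‖ ≤ 4 * ‖x + g * α‖ := by
  set ξ := x + g * α with hξ
  have h1 : ξ.re = x.re + α.re + ((g - 1) * α).re := by
    rw [hξ]; simp; ring
  have h2 : ((g - 1) * α).re ≤ a * t :=
    (Complex.re_le_norm _).trans (by
      rw [norm_mul]; exact (mul_le_of_le_one_left (norm_nonneg _) hg).trans hα)
  have h3 : ‖x‖ ≤ ‖ξ‖ + t := by
    have : x = ξ - g * α := by rw [hξ]; ring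
    calc ‖x‖ = ‖ξ - g * α‖ := by rw [← this]
      _ ≤ ‖ξ‖ + ‖g * α‖ := norm_sub_le _ _
      _ ≤ ‖ξ‖ + t := by
        rw [norm_mul]
        have : ‖g‖ * ‖α‖ ≤ ‖α‖ := mul_le_of_le_one_left (norm_nonneg _) hg'
        nlinarith
  have h4 : -‖ξ‖ ≤ ξ.re := (abs_le.1 (Complex.abs_re_le_norm ξ)).1
  have h5 := norm_nonneg ξ
  have h6 : ξ.re ≤ c / 4 * ‖ξ‖ - (3 / 4) * (c * t) := by nlinarith
  have h7 : c / 4 * ‖ξ‖ ≤ 1 / 4 * ‖ξ‖ := by gcongr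
  have h8 : 0 ≤ c * t := by positivity
  refine ⟨by nlinarith, by nlinarith, by nlinarith⟩

section ModelMap

variable {V : Type*} [NormedAddCommGroup V] [InnerProductSpace ℂ V]

/-- The component of `z` orthogonal to the unit vector `e`. -/
noncomputable def tangentialPart (e z : V) : V := z - inner ℂ e z • e

lemma inner_tangentialPart {e : V} (he : ‖e‖ = 1) (z : V) :
    inner ℂ e (tangentialPart e z) = 0 := by
  simp [tangentialPart, inner_self_eq_norm_sq_to_K, he]

lemma smul_add_tangentialPart (e z : V) : inner ℂ e z • e + tangentialPart e z = z := by
  simp [tangentialPart]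

lemma inner_smul_add {e w : V} (he : ‖e‖ = 1) (hw : inner ℂ e w = 0) (c : ℂ) :
    inner ℂ e (c • e + w) = c := by
  simp [inner_self_eq_norm_sq_to_K, he, hw]

lemma tangentialPart_smul_add {e w : V} (he : ‖e‖ = 1) (hw : inner ℂ e w = 0) (c : ℂ) :
    tangentialPart e (c • e + w) = w := by
  rw [tangentialPart, inner_smul_add he hw]; simp

lemma norm_sq_smul_add {e w : V} (he : ‖e‖ = 1) (hw : inner ℂ e w = 0) (c : ℂ) :
    ‖c • e + w‖ ^ 2 = ‖c‖ ^ 2 + ‖w‖ ^ 2 := by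
  have h : inner ℂ (c • e) w = 0 := by rw [inner_smul_left, hw, mul_zero]
  have := norm_add_sq_eq_norm_sq_add_norm_sq_of_inner_eq_zero (c • e) w h
  simp only [norm_smul, he, mul_one] at this
  linarith

lemma norm_sq_eq_tangentialPart {e : V} (he : ‖e‖ = 1) (z : V) :
    ‖z‖ ^ 2 = ‖inner ℂ e z‖ ^ 2 + ‖tangentialPart e z‖ ^ 2 := by
  rw [← norm_sq_smul_add he (inner_tangentialPart he z), smul_add_tangentialPart]

lemma norm_tangentialPart_le {e : V} (he : ‖e‖ = 1) (z : V) : ‖tangentialPart e z‖ ≤ ‖z‖ := by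
  have := norm_sq_eq_tangentialPart he z
  exact le_of_sq_le_sq (by nlinarith [sq_nonneg ‖inner ℂ e z‖]) (norm_nonneg _)

lemma norm_inner_unit_le {e : V} (he : ‖e‖ = 1) (z : V) : ‖inner ℂ e z‖ ≤ ‖z‖ := by
  simpa [he] using norm_inner_le_norm (𝕜 := ℂ) e z

lemma differentiable_tangentialPart (e : V) : Differentiable ℂ (tangentialPart e) := by
  have : Differentiable ℂ (fun z : V => inner ℂ e z) := (innerSL ℂ e).differentiable
  unfold tangentialPart
  fun_prop

lemma norm_quadratic_sub_tangentialPart_le (B : V →L[ℂ] V →L[ℂ] ℂ) {M : ℝ} (hM : ‖B‖ ≤ M) {e : V}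
    (he : ‖e‖ = 1) (z : V) :
    ‖B z z - B (tangentialPart e z) (tangentialPart e z)‖ ≤ 3 * M * ‖inner ℂ e z‖ * ‖z‖ := by
  set c := inner ℂ e z with hc
  set w := tangentialPart e z with hw
  have hz : z = c • e + w := (smul_add_tangentialPart e z).symm
  have hB : ∀ u v : V, ‖B u v‖ ≤ M * ‖u‖ * ‖v‖ := fun u v =>
    (B.le_opNorm₂ u v).trans (by gcongr)
  have h1 : B z z - B w w = c * B e z + c * B w e := by
    conv_lhs => rw [hz]
    conv_rhs => rw [hz]
    simp only [map_add, map_smul, _root_.add_apply, _root_.smul_apply,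
      smul_eq_mul]
    ring
  have hM0 : 0 ≤ M := (norm_nonneg B).trans hM
  have hwz : ‖w‖ ≤ ‖z‖ := norm_tangentialPart_le he z
  have h2 := hB e z
  have h3 := hB w e
  rw [he] at h2 h3
  have h4 : M * ‖w‖ * 1 ≤ M * ‖z‖ := by rw [mul_one]; gcongr
  have h5 : 0 ≤ M * ‖z‖ := by positivity
  calc ‖B z z - B w w‖ ≤ ‖c‖ * ‖B e z‖ + ‖c‖ * ‖B w e‖ := by
        rw [h1, ← norm_mul, ← norm_mul]; exact norm_add_le _ _
    _ ≤ ‖c‖ * (M * ‖z‖) + ‖c‖ * (M * ‖z‖) := by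
        gcongr <;> linarith
    _ ≤ 3 * M * ‖c‖ * ‖z‖ := by nlinarith [mul_nonneg (norm_nonneg c) h5]

/-- The height `λ ⟪e, z⟫` of `z` over the complex tangent hyperplane `e⊥`. -/
noncomputable def height (e : V) (lam : ℝ) (z : V) : ℂ := lam * inner ℂ e z

lemma differentiable_height (e : V) (lam : ℝ) : Differentiable ℂ (height e lam) := by
  have : Differentiable ℂ (fun z : V => inner ℂ e z) := (innerSL ℂ e).differentiable
  unfold height
  fun_prop

/-- The height after the shear that removes the pluriharmonic quadratic part `B`; the shear is
switched off far from the origin by the factor `(1 - N x)⁻¹`. -/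
noncomputable def shearedHeight (B : V →L[ℂ] V →L[ℂ] ℂ) (e : V) (lam N : ℝ) (z : V) : ℂ :=
  height e lam z
    + (1 - N * height e lam z)⁻¹ * B (tangentialPart e z) (tangentialPart e z)

/-- The tangential coordinate matching `shearedHeight`. -/
noncomputable def dampedTangentialPart (e : V) (lam N : ℝ) (z : V) : V :=
  (1 - N * height e lam z) ^ (-1 / 2 : ℂ) • tangentialPart e z

/-- The shear followed by the Cayley transform of the Siegel domain
`Re ξ + ‖w‖² < 0` centred at height `-δ`. -/
noncomputable def modelMap (B : V →L[ℂ] V →L[ℂ] ℂ) (e : V) (lam N δ : ℝ) (z : V) : V :=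
  ((shearedHeight B e lam N z + δ) / (shearedHeight B e lam N z - δ)) • e
    + ((2 * √δ : ℝ) / (shearedHeight B e lam N z - δ)) • dampedTangentialPart e lam N z

lemma cpow_neg_half_mul_self {m : ℂ} (hm : m ≠ 0) :
    m ^ (-1 / 2 : ℂ) * m ^ (-1 / 2 : ℂ) = m⁻¹ := by
  rw [← Complex.cpow_add _ _ hm, ← Complex.cpow_neg_one]; norm_num

lemma inner_dampedTangentialPart {e : V} (he : ‖e‖ = 1) (lam N : ℝ) (z : V) :
    inner ℂ e (dampedTangentialPart e lam N z) = 0 := by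
  rw [dampedTangentialPart, inner_smul_right, inner_tangentialPart he, mul_zero]

lemma norm_sq_dampedTangentialPart {e : V} {lam N : ℝ} {z : V}
    (hm : 1 - N * height e lam z ≠ 0) :
    ‖dampedTangentialPart e lam N z‖ ^ 2
      = ‖(1 - N * height e lam z)⁻¹‖ * ‖tangentialPart e z‖ ^ 2 := by
  rw [dampedTangentialPart, norm_smul, mul_pow, sq ‖_ ^ _‖, ← norm_mul, cpow_neg_half_mul_self hm]

lemma shearedHeight_eq (B : V →L[ℂ] V →L[ℂ] ℂ) {e : V} {lam N : ℝ} {z : V}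
    (hm : 1 - N * height e lam z ≠ 0) :
    shearedHeight B e lam N z = height e lam z
      + B (dampedTangentialPart e lam N z) (dampedTangentialPart e lam N z) := by
  rw [shearedHeight, ← cpow_neg_half_mul_self hm, dampedTangentialPart]
  simp only [map_smul, _root_.smul_apply, smul_eq_mul]
  ring

lemma norm_sq_modelMap (B : V →L[ℂ] V →L[ℂ] ℂ) {e : V} (he : ‖e‖ = 1) {lam N δ : ℝ} (hδ : 0 < δ)
    {z : V} (h : shearedHeight B e lam N z - δ ≠ 0) :
    ‖modelMap B e lam N δ z‖ ^ 2 = 1 + 4 * δ * ((shearedHeight B e lam N z).re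
      + ‖dampedTangentialPart e lam N z‖ ^ 2) / ‖shearedHeight B e lam N z - δ‖ ^ 2 := by
  rw [modelMap, norm_sq_smul_add he (by rw [inner_smul_right, inner_dampedTangentialPart he,
    mul_zero]), ← cayley_norm_sq _ h, norm_smul, mul_pow, norm_div ((2 * √δ : ℝ) : ℂ), div_pow ‖((2 * √δ : ℝ) : ℂ)‖]
  have : ‖((2 * √δ : ℝ) : ℂ)‖ ^ 2 = 4 * δ := by
    rw [Complex.norm_real, Real.norm_eq_abs, sq_abs, mul_pow, Real.sq_sqrt hδ.le]; norm_num
  rw [this]; ring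

lemma differentiableOn_modelMap (B : V →L[ℂ] V →L[ℂ] ℂ) (e : V) (lam N δ : ℝ) {W : Set V}
    (hm : ∀ z ∈ W, 0 < (1 - N * height e lam z).re)
    (h : ∀ z ∈ W, shearedHeight B e lam N z - δ ≠ 0) :
    DifferentiableOn ℂ (modelMap B e lam N δ) W := by
  intro z hz
  have h1 : DifferentiableAt ℂ (height e lam) z := differentiable_height e lam z
  have h2 : DifferentiableAt ℂ (tangentialPart e) z := differentiable_tangentialPart e z
  have hm0 : 1 - N * height e lam z ≠ 0 := fun h0 => by
    have := hm z hz; rw [h0] at this; simp at this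
  have h3 : DifferentiableAt ℂ (shearedHeight B e lam N) z := by
    unfold shearedHeight
    have : DifferentiableAt ℂ (fun z => (1 - N * height e lam z)⁻¹) z :=
      ((differentiableAt_const _).sub (h1.const_mul _)).inv hm0
    have hB : DifferentiableAt ℂ (fun z => B (tangentialPart e z)) z :=
      B.differentiableAt.comp z h2
    exact h1.add (this.mul (hB.clm_apply h2))
  have h4 : DifferentiableAt ℂ (dampedTangentialPart e lam N) z := by
    unfold dampedTangentialPart
    refine DifferentiableAt.smul ?_ h2
    exact DifferentiableAt.cpow ((differentiableAt_const _).sub (h1.const_mul _))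
      (differentiableAt_const _) (Or.inl (hm z hz))
  have h5 : DifferentiableAt ℂ (fun z => shearedHeight B e lam N z - δ) z :=
    h3.sub (differentiableAt_const _)
  refine DifferentiableAt.differentiableWithinAt ?_
  have h6 : DifferentiableAt ℂ
      (fun z => (shearedHeight B e lam N z + δ) / (shearedHeight B e lam N z - δ)) z := by
    simp only [div_eq_mul_inv]
    exact (h3.add (differentiableAt_const _)).mul (h5.inv (h z hz))
  have h7 : DifferentiableAt ℂ
      (fun z => ((2 * √δ : ℝ) : ℂ) / (shearedHeight B e lam N z - δ)) z := by
    simp only [div_eq_mul_inv]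
    exact (h5.inv (h z hz)).const_mul _
  exact (h6.smul (differentiableAt_const e)).add (h7.smul h4)

lemma injOn_modelMap (B : V →L[ℂ] V →L[ℂ] ℂ) {e : V} (he : ‖e‖ = 1) {lam N δ : ℝ}
    (hlam : lam ≠ 0) (hδ : 0 < δ) {W : Set V}
    (hm : ∀ z ∈ W, 1 - N * height e lam z ≠ 0)
    (h : ∀ z ∈ W, shearedHeight B e lam N z - δ ≠ 0) :
    InjOn (modelMap B e lam N δ) W := by
  intro z hz z' hz' heq
  have horth : ∀ u, inner ℂ e (((2 * √δ : ℝ) / (shearedHeight B e lam N u - δ)) •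
      dampedTangentialPart e lam N u) = 0 := fun u => by
    rw [inner_smul_right, inner_dampedTangentialPart he, mul_zero]
  have h1 := congrArg (inner ℂ e) heq
  have h2 := congrArg (tangentialPart e) heq
  simp only [modelMap] at h1 h2
  rw [inner_smul_add he (horth z), inner_smul_add he (horth z'),
    div_eq_div_iff (h z hz) (h z' hz')] at h1
  rw [tangentialPart_smul_add he (horth z), tangentialPart_smul_add he (horth z')] at h2
  have hδ' : (δ : ℂ) ≠ 0 := by exact_mod_cast hδ.ne'
  have h3 : shearedHeight B e lam N z = shearedHeight B e lam N z' := by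
    have : 2 * (δ : ℂ) * (shearedHeight B e lam N z - shearedHeight B e lam N z') = 0 := by
      linear_combination -h1
    have h' := (mul_eq_zero.1 this).resolve_left (mul_ne_zero two_ne_zero hδ')
    exact sub_eq_zero.1 h'
  rw [h3] at h2
  have h4 : dampedTangentialPart e lam N z = dampedTangentialPart e lam N z' := by
    refine smul_right_injective V (div_ne_zero ?_ (h z' hz')) h2
    have : (0 : ℝ) < 2 * √δ := by positivity
    exact_mod_cast this.ne'
  have h5 : height e lam z = height e lam z' := by
    have e1 := shearedHeight_eq B (hm z hz)
    have e2 := shearedHeight_eq B (hm z' hz')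
    rw [h4] at e1
    rw [e1, e2] at h3
    exact add_right_cancel h3
  have h6 : tangentialPart e z = tangentialPart e z' := by
    unfold dampedTangentialPart at h4
    rw [h5] at h4
    exact smul_right_injective V ((Complex.cpow_ne_zero_iff_of_exponent_ne_zero (by norm_num)).2 (hm z' hz')) h4
  have h7 : inner ℂ e z = inner ℂ e z' := by
    unfold height at h5
    exact mul_left_cancel₀ (by exact_mod_cast hlam) h5
  rw [← smul_add_tangentialPart e z, h6, h7, smul_add_tangentialPart]

lemma modelMap_center (B : V →L[ℂ] V →L[ℂ] ℂ) {e : V} (he : ‖e‖ = 1) {lam N δ : ℝ}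
    (hlam : lam ≠ 0) : modelMap B e lam N δ (-((δ / lam : ℝ) : ℂ) • e) = 0 := by
  have h := tangentialPart_smul_add he (inner_zero_right e) (-((δ / lam : ℝ) : ℂ))
  have h' := inner_smul_add he (inner_zero_right e) (-((δ / lam : ℝ) : ℂ))
  rw [add_zero] at h h'
  have hl : (lam : ℂ) ≠ 0 := by exact_mod_cast hlam
  have h3 : shearedHeight B e lam N (-((δ / lam : ℝ) : ℂ) • e) = -δ := by
    rw [shearedHeight, h, height, h']
    simp; field_simp
  rw [modelMap, h3, dampedTangentialPart, h]
  simp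

/-- `W` lies over the half-space `Re (height e lam z) ≤ 0`, stays away from its boundary outside
`closedBall 0 r₀`, and is given inside `closedBall 0 r₀` by
`Re (height e lam z) + Re (B z z) + ‖z‖ ^ 2 < 0` up to an error `η * ‖z‖ ^ 2`. -/
structure IsNearlyQuadratic (W : Set V) (B : V →L[ℂ] V →L[ℂ] ℂ) (e : V)
    (lam a M K D c₁ r₀ η : ℝ) : Prop where
  norm_eq_one : ‖e‖ = 1
  lam_pos : 0 < lam
  inv_le : lam⁻¹ ≤ K
  norm_quadratic_le : ∀ z, ‖B z z‖ ≤ a * ‖z‖ ^ 2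
  norm_le : ‖B‖ ≤ M
  bounded : ∀ z ∈ W, ‖z‖ ≤ D
  re_nonpos : ∀ z ∈ W, (height e lam z).re ≤ 0
  far : ∀ z ∈ W, r₀ ≤ ‖z‖ → c₁ ≤ ‖height e lam z‖
  near : ∀ z ∈ W, ‖z‖ ≤ r₀ → (height e lam z).re + (B z z).re + ‖z‖ ^ 2 ≤ η * ‖z‖ ^ 2
  mem : ∀ z, ‖z‖ ≤ r₀ → (height e lam z).re + (B z z).re + ‖z‖ ^ 2 + η * ‖z‖ ^ 2 < 0 → z ∈ W

namespace IsNearlyQuadratic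

variable {W : Set V} {B : V →L[ℂ] V →L[ℂ] ℂ} {e : V} {lam a M K D c₁ r₀ η : ℝ}

lemma norm_inner_le (h : IsNearlyQuadratic W B e lam a M K D c₁ r₀ η) (z : V) :
    ‖inner ℂ e z‖ ≤ K * ‖height e lam z‖ := by
  have h1 : ‖inner ℂ e z‖ = lam⁻¹ * ‖height e lam z‖ := by
    have := h.lam_pos
    rw [height, norm_mul, Complex.norm_real, Real.norm_eq_abs, abs_of_pos this]
    field_simp
  rw [h1]
  exact mul_le_mul_of_nonneg_right h.inv_le (norm_nonneg _)

lemma near_bounds (h : IsNearlyQuadratic W B e lam a M K D c₁ r₀ η) {c N : ℝ} (hN : 0 < N)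
    (ha : a ≤ 1) (hη : η ≤ 1) (hc : 0 < c) (hc1 : c ≤ 1) (hac : a + η + c ≤ 1)
    (hr : 3 * M * K * r₀ ≤ c / 4) {z : V} (hz : z ∈ W) (hzr : ‖z‖ ≤ r₀) :
    (shearedHeight B e lam N z).re ≤ ‖shearedHeight B e lam N z‖ / 2 ∧
    c * ‖tangentialPart e z‖ ^ 2 ≤ 3 * ‖shearedHeight B e lam N z‖ ∧
    c * ‖height e lam z‖ ≤ 4 * ‖shearedHeight B e lam N z‖ ∧
    (shearedHeight B e lam N z).re + ‖dampedTangentialPart e lam N z‖ ^ 2 ≤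
      η * ‖tangentialPart e z‖ ^ 2
        + (3 * M * K * ‖z‖ + N * ‖tangentialPart e z‖ ^ 2) * ‖height e lam z‖ := by
  have hx := h.re_nonpos z hz
  obtain ⟨hm, hg1, hg2, hg3, -⟩ := cutoff_bounds hN hx
  have hm0 : 1 - N * height e lam z ≠ 0 := fun h0 => by rw [h0] at hm; simp at hm
  have hτ := norm_sq_dampedTangentialPart (e := e) hm0
  have hnear := h.near z hz hzr
  have hquad := norm_quadratic_sub_tangentialPart_le B h.norm_le h.norm_eq_one z
  have hpyth := norm_sq_eq_tangentialPart h.norm_eq_one z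
  have hin := h.norm_inner_le z
  have hα := h.norm_quadratic_le (tangentialPart e z)
  have hM : 0 ≤ M := (norm_nonneg B).trans h.norm_le
  have hK : 0 ≤ K := (inv_nonneg.2 h.lam_pos.le).trans h.inv_le
  have hre := (abs_le.1 (Complex.abs_re_le_norm
    (B z z - B (tangentialPart e z) (tangentialPart e z)))).1
  rw [Complex.sub_re] at hre
  rw [hτ]
  unfold shearedHeight
  set x := height e lam z
  set w := tangentialPart e z
  set g := (1 - N * x)⁻¹
  set α := B w w
  set i := ‖inner ℂ e z‖
  have hE : 3 * M * i * ‖z‖ ≤ 3 * M * K * ‖z‖ * ‖x‖ := by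
    have : 0 ≤ 3 * M * ‖z‖ := by positivity
    nlinarith
  have hηi : η * i ^ 2 ≤ i ^ 2 := mul_le_of_le_one_left (sq_nonneg _) hη
  have hmain : x.re + α.re + ‖w‖ ^ 2 ≤ η * ‖w‖ ^ 2 + 3 * M * K * ‖z‖ * ‖x‖ := by
    rw [hpyth] at hnear
    nlinarith
  have hE2 : 3 * M * K * ‖z‖ * ‖x‖ ≤ c / 4 * ‖x‖ := by
    refine mul_le_mul_of_nonneg_right (le_trans ?_ hr) (norm_nonneg _)
    gcongr
  obtain ⟨h1, h2, h3⟩ := sheared_height_bounds (sq_nonneg ‖w‖) hα ha hc hc1 hac hg2 hg1 hmain hE2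
  refine ⟨h1, h2, h3, ?_⟩
  have h4 : (x + g * α).re = x.re + α.re + ((g - 1) * α).re := by simp; ring
  have h5 : ((g - 1) * α).re ≤ N * ‖x‖ * ‖w‖ ^ 2 := by
    refine (Complex.re_le_norm _).trans ?_
    rw [norm_mul]
    refine mul_le_mul hg3 (hα.trans ?_) (norm_nonneg _) (by positivity)
    exact mul_le_of_le_one_left (sq_nonneg _) ha
  have h6 : ‖g‖ * ‖w‖ ^ 2 ≤ ‖w‖ ^ 2 := mul_le_of_le_one_left (sq_nonneg _) hg1
  nlinarith

lemma near_norm_sq_le (h : IsNearlyQuadratic W B e lam a M K D c₁ r₀ η)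
    (hr : K * r₀ ≤ 1) {z : V} (hzr : ‖z‖ ≤ r₀) :
    ‖z‖ ^ 2 ≤ ‖tangentialPart e z‖ ^ 2 + ‖height e lam z‖ := by
  have hK : 0 ≤ K := (inv_nonneg.2 h.lam_pos.le).trans h.inv_le
  have h1 := h.norm_inner_le z
  have h2 := norm_inner_unit_le h.norm_eq_one z
  have h3 := norm_sq_eq_tangentialPart h.norm_eq_one z
  have h4 : ‖inner ℂ e z‖ ^ 2 ≤ (K * ‖z‖) * ‖height e lam z‖ := by
    nlinarith [norm_nonneg (inner ℂ e z), norm_nonneg z]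
  have h5 : (K * ‖z‖) * ‖height e lam z‖ ≤ 1 * ‖height e lam z‖ := by
    gcongr
    exact (mul_le_mul_of_nonneg_left hzr hK).trans hr
  linarith

lemma far_bounds (h : IsNearlyQuadratic W B e lam a M K D c₁ r₀ η) {N : ℝ} (hN : 0 < N)
    (ha : a ≤ 1) (hc₁ : 0 < c₁) (hND : 2 * D ^ 2 ≤ N * c₁ ^ 2) {z : V} (hz : z ∈ W)
    (hzr : r₀ ≤ ‖z‖) : c₁ / 2 ≤ ‖shearedHeight B e lam N z‖ := by
  have hfar := h.far z hz hzr
  obtain ⟨-, -, -, -, hg⟩ := cutoff_bounds hN (h.re_nonpos z hz)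
  have hα := h.norm_quadratic_le (tangentialPart e z)
  have hw := (norm_tangentialPart_le h.norm_eq_one z).trans (h.bounded z hz)
  unfold shearedHeight
  set x := height e lam z
  set w := tangentialPart e z
  set g := (1 - N * x)⁻¹
  have hα' : ‖B w w‖ ≤ D ^ 2 :=
    hα.trans ((mul_le_of_le_one_left (sq_nonneg _) ha).trans (by gcongr))
  have h1 : ‖g‖ * (N * c₁) ≤ 1 := le_trans (by gcongr) hg
  have h2 : ‖g * B w w‖ ≤ c₁ / 2 := by
    rw [norm_mul]
    have : ‖g‖ * ‖B w w‖ ≤ ‖g‖ * D ^ 2 := by gcongr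
    have h3 : ‖g‖ * (2 * D ^ 2) ≤ ‖g‖ * (N * c₁ ^ 2) := by gcongr
    have h4 : ‖g‖ * (N * c₁) * c₁ ≤ 1 * c₁ := by gcongr
    nlinarith
  have h3 : ‖x‖ - ‖g * B w w‖ ≤ ‖x + g * B w w‖ := by
    have := norm_sub_norm_le x (-(g * B w w))
    rwa [norm_neg, sub_neg_eq_add] at this
  linarith

lemma re_add_le (h : IsNearlyQuadratic W B e lam a M K D c₁ r₀ η) {N : ℝ} (hN : 0 < N)
    (ha : a ≤ 1) {z : V} (hz : z ∈ W) :
    (shearedHeight B e lam N z).re + ‖dampedTangentialPart e lam N z‖ ^ 2 ≤ 2 * D ^ 2 := by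
  have hx := h.re_nonpos z hz
  obtain ⟨hm, hg, -, -, -⟩ := cutoff_bounds hN hx
  have hm0 : 1 - N * height e lam z ≠ 0 := fun h0 => by rw [h0] at hm; simp at hm
  have hα := h.norm_quadratic_le (tangentialPart e z)
  have hw := (norm_tangentialPart_le h.norm_eq_one z).trans (h.bounded z hz)
  rw [norm_sq_dampedTangentialPart (e := e) hm0]
  unfold shearedHeight
  set x := height e lam z
  set w := tangentialPart e z
  set g := (1 - N * x)⁻¹
  have hw2 : ‖w‖ ^ 2 ≤ D ^ 2 := by gcongr
  have hα' : ‖B w w‖ ≤ D ^ 2 := hα.trans ((mul_le_of_le_one_left (sq_nonneg _) ha).trans hw2)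
  have h1 : ‖g‖ * ‖w‖ ^ 2 ≤ ‖w‖ ^ 2 := mul_le_of_le_one_left (sq_nonneg _) hg
  have h2 : (g * B w w).re ≤ ‖B w w‖ := (Complex.re_le_norm _).trans (by
    rw [norm_mul]; exact mul_le_of_le_one_left (norm_nonneg _) hg)
  rw [Complex.add_re]
  linarith

end IsNearlyQuadratic

/-- Outer estimate: the model map sends `W` into a slightly enlarged unit ball. -/
lemma exists_modelMap_outer {ε a M K D c₁ r₀ η c : ℝ} (hε : 0 < ε) (hM : 0 ≤ M) (hK : 0 ≤ K)
    (hD : 0 < D) (hc₁ : 0 < c₁) (ha : a ≤ 1) (hη : η ≤ 1) (hc : 0 < c)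
    (hc1 : c ≤ 1) (hac : a + η + c ≤ 1) (hr : 3 * M * K * r₀ ≤ c / 4) (hKr : K * r₀ ≤ 1)
    (hηε : η ≤ c * ε / 24) :
    ∃ N > 0, ∃ δ₀ > 0, ∀ (W : Set V) (B : V →L[ℂ] V →L[ℂ] ℂ) (e : V) (lam : ℝ),
      IsNearlyQuadratic W B e lam a M K D c₁ r₀ η → ∀ δ : ℝ, 0 < δ → δ < δ₀ → ∀ z ∈ W,
        shearedHeight B e lam N z - δ ≠ 0 ∧ ‖modelMap B e lam N δ z‖ ^ 2 ≤ 1 + ε := by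
  obtain ⟨N, hN, hND⟩ : ∃ N : ℝ, 0 < N ∧ 2 * D ^ 2 ≤ N * c₁ ^ 2 :=
    ⟨2 * D ^ 2 / c₁ ^ 2, by positivity, by field_simp; rfl⟩
  obtain ⟨r₁, hr₁, hr₁1, hr₁ε⟩ : ∃ r₁ : ℝ, 0 < r₁ ∧ r₁ ≤ 1 ∧
      (3 * M * K + N) * r₁ ≤ c * ε / 32 := by
    have hpos : 0 < 3 * M * K + N := by positivity
    refine ⟨min 1 (c * ε / 32 / (3 * M * K + N)), by positivity, min_le_left _ _, ?_⟩
    calc (3 * M * K + N) * min 1 (c * ε / 32 / (3 * M * K + N))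
        ≤ (3 * M * K + N) * (c * ε / 32 / (3 * M * K + N)) := by gcongr; exact min_le_right _ _
      _ = c * ε / 32 := by field_simp
  set c₂ := min (c * r₁ ^ 2 / 7) (c₁ / 2) with hc₂
  have hc₂pos : 0 < c₂ := by positivity
  refine ⟨N, hN, min (c₂ / 2) (ε * c₂ ^ 2 / (32 * D ^ 2)), by positivity, ?_⟩
  intro W B e lam h δ hδ hδ₀ z hz
  have hδ1 : δ ≤ c₂ / 2 := hδ₀.le.trans (min_le_left _ _)
  have hδ2 : δ * (32 * D ^ 2) ≤ ε * c₂ ^ 2 := by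
    rw [← le_div_iff₀ (by positivity)]; exact hδ₀.le.trans (min_le_right _ _)
  have key : ∀ {ξ : ℂ} {τ : ℝ}, ξ - δ ≠ 0 → 4 * δ * (ξ.re + τ) ≤ ε * ‖ξ - δ‖ ^ 2 →
      1 + 4 * δ * (ξ.re + τ) / ‖ξ - δ‖ ^ 2 ≤ 1 + ε := fun {ξ τ} h0 h1 => by
    have : 0 < ‖ξ - δ‖ := norm_pos_iff.2 h0
    gcongr
    rw [div_le_iff₀ (by positivity)]; exact h1
  by_cases hzr₁ : ‖z‖ ≤ r₀ ∧ ‖z‖ ≤ r₁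
  · obtain ⟨h1, h2, h3, h4⟩ := h.near_bounds hN ha hη hc hc1 hac hr hz hzr₁.1
    obtain ⟨h5, h6⟩ := mul_norm_le_norm_sub_sq hδ h1
    refine ⟨h6, ?_⟩
    rw [norm_sq_modelMap B h.norm_eq_one hδ h6]
    refine key h6 ?_
    have hw := norm_tangentialPart_le h.norm_eq_one z
    set ξ := shearedHeight B e lam N z
    set t := ‖tangentialPart e z‖ with ht
    have ht0 : 0 ≤ t := norm_nonneg _
    have h7 : η * t ^ 2 ≤ ε / 8 * ‖ξ‖ := by
      have : η * t ^ 2 ≤ c * ε / 24 * t ^ 2 := by gcongr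
      have h' : ε / 24 * (c * t ^ 2) ≤ ε / 24 * (3 * ‖ξ‖) := by gcongr
      linarith
    have h8 : 3 * M * K * ‖z‖ + N * t ^ 2 ≤ c * ε / 32 := by
      refine le_trans ?_ hr₁ε
      have : t ^ 2 ≤ r₁ := by nlinarith [hzr₁.2]
      have h' : 3 * M * K * ‖z‖ ≤ 3 * M * K * r₁ := by gcongr; exact hzr₁.2
      nlinarith
    have h9 : (3 * M * K * ‖z‖ + N * t ^ 2) * ‖height e lam z‖ ≤ ε / 8 * ‖ξ‖ := by
      have : (3 * M * K * ‖z‖ + N * t ^ 2) * ‖height e lam z‖ ≤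
        c * ε / 32 * ‖height e lam z‖ := by gcongr
      have h' : ε / 32 * (c * ‖height e lam z‖) ≤ ε / 32 * (4 * ‖ξ‖) := by gcongr
      linarith
    have h10 : ξ.re + ‖dampedTangentialPart e lam N z‖ ^ 2 ≤ ε / 4 * ‖ξ‖ := by linarith
    have h11 : 4 * δ * (ξ.re + ‖dampedTangentialPart e lam N z‖ ^ 2) ≤ 4 * δ * (ε / 4 * ‖ξ‖) := by
      gcongr
    have h12 : ε * (δ * ‖ξ‖) ≤ ε * ‖ξ - δ‖ ^ 2 := by gcongr
    linarith
  · have hξ : c₂ ≤ ‖shearedHeight B e lam N z‖ := by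
      by_cases hzr : ‖z‖ ≤ r₀
      · have hzr₂ : r₁ < ‖z‖ := by
          by_contra hcon; exact hzr₁ ⟨hzr, not_lt.1 hcon⟩
        obtain ⟨-, h2, h3, -⟩ := h.near_bounds hN ha hη hc hc1 hac hr hz hzr
        have h4 := h.near_norm_sq_le hKr hzr
        have h5 : r₁ ^ 2 ≤ ‖z‖ ^ 2 := by gcongr
        refine (min_le_left _ _).trans ?_
        nlinarith
      · exact (min_le_right _ _).trans (h.far_bounds hN ha hc₁ hND hz (not_le.1 hzr).le)
    have h1 : c₂ / 2 ≤ ‖shearedHeight B e lam N z - δ‖ := by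
      have := norm_sub_norm_le (shearedHeight B e lam N z) δ
      rw [Complex.norm_real, Real.norm_eq_abs, abs_of_pos hδ] at this
      linarith
    have h0 : shearedHeight B e lam N z - δ ≠ 0 := norm_pos_iff.1 (by linarith)
    refine ⟨h0, ?_⟩
    rw [norm_sq_modelMap B h.norm_eq_one hδ h0]
    refine key h0 ?_
    have h2 := h.re_add_le hN ha hz
    have h3 : (c₂ / 2) ^ 2 ≤ ‖shearedHeight B e lam N z - δ‖ ^ 2 := by gcongr
    have h4 : 4 * δ * ((shearedHeight B e lam N z).re + ‖dampedTangentialPart e lam N z‖ ^ 2)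
      ≤ 4 * δ * (2 * D ^ 2) := by gcongr
    have h5 : ε * (c₂ / 2) ^ 2 ≤ ε * ‖shearedHeight B e lam N z - δ‖ ^ 2 := by gcongr
    linarith

/-- Explicit preimages under the model map. -/
lemma modelMap_preimage (B : V →L[ℂ] V →L[ℂ] ℂ) {e : V} (he : ‖e‖ = 1) {lam N δ : ℝ}
    (hlam : lam ≠ 0) (hδ : 0 < δ) {y ζ : V} {u ξ x : ℂ} (hu : u = inner ℂ e y - 1) (hu0 : u ≠ 0)
    (hξ : ξ = δ * (inner ℂ e y + 1) / u) (hζ : ζ = ((√δ : ℝ) / u) • tangentialPart e y)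
    (hx : x = ξ - B ζ ζ) (hm : 1 - N * x ≠ 0) :
    ∃ z, height e lam z = x ∧ tangentialPart e z = (1 - N * x) ^ (1 / 2 : ℂ) • ζ ∧
      dampedTangentialPart e lam N z = ζ ∧ shearedHeight B e lam N z = ξ ∧
      ξ - δ = 2 * δ / u ∧ modelMap B e lam N δ z = y := by
  have hl : (lam : ℂ) ≠ 0 := by exact_mod_cast hlam
  have hδ' : (δ : ℂ) ≠ 0 := by exact_mod_cast hδ.ne'
  have hsq : ((√δ : ℝ) : ℂ) * ((√δ : ℝ) : ℂ) = δ := by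
    rw [← Complex.ofReal_mul, Real.mul_self_sqrt hδ.le]
  have hort : inner ℂ e ((1 - N * x) ^ (1 / 2 : ℂ) • ζ) = 0 := by
    rw [hζ, inner_smul_right, inner_smul_right, inner_tangentialPart he]; simp
  have h1 : height e lam ((x / lam) • e + (1 - N * x) ^ (1 / 2 : ℂ) • ζ) = x := by
    rw [height, inner_smul_add he hort]; field_simp
  have h2 := tangentialPart_smul_add he hort (x / lam)
  have h3 : dampedTangentialPart e lam N ((x / lam) • e + (1 - N * x) ^ (1 / 2 : ℂ) • ζ) = ζ := by
    rw [dampedTangentialPart, h1, h2, smul_smul, ← Complex.cpow_add _ _ hm]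
    norm_num
  have h4 : shearedHeight B e lam N ((x / lam) • e + (1 - N * x) ^ (1 / 2 : ℂ) • ζ) = ξ := by
    rw [shearedHeight_eq B (by rw [h1]; exact hm), h1, h3, hx]; ring
  have h5 : ξ - δ = 2 * δ / u := by
    rw [hξ]; field_simp; rw [hu]; ring
  refine ⟨_, h1, h2, h3, h4, h5, ?_⟩
  have h6 : ξ + δ = 2 * δ / u * inner ℂ e y := by
    rw [hξ]; field_simp; rw [hu]; ring
  have h7 : (2 * δ / u : ℂ) ≠ 0 := div_ne_zero (mul_ne_zero two_ne_zero hδ') hu0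
  rw [modelMap, h4, h3, h5, h6, mul_div_cancel_left₀ _ h7, hζ, smul_smul]
  have h8 : ((2 * √δ : ℝ) : ℂ) / (2 * δ / u) * ((√δ : ℝ) / u) = 1 := by
    rw [Complex.ofReal_mul, Complex.ofReal_ofNat]
    field_simp
    linear_combination hsq
  rw [h8, one_smul, smul_add_tangentialPart]

set_option maxHeartbeats 1000000 in
/-- Inner estimate: the image of `W` under the model map contains a slightly smaller ball. -/
lemma exists_modelMap_inner {ε a M K D c₁ r₀ η N : ℝ} (hε : 0 < ε) (hε1 : ε ≤ 1) (hM : 0 ≤ M)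
    (hK : 0 ≤ K) (hr₀ : 0 < r₀) (ha : a ≤ 1) (hη0 : 0 ≤ η) (hη : η ≤ ε ^ 3 / 48)
    (hN : 0 < N) :
    ∃ δ₀ > 0, ∀ (W : Set V) (B : V →L[ℂ] V →L[ℂ] ℂ) (e : V) (lam : ℝ),
      IsNearlyQuadratic W B e lam a M K D c₁ r₀ η → ∀ δ : ℝ, 0 < δ → δ < δ₀ →
        ball 0 (1 - ε) ⊆ modelMap B e lam N δ '' W := by
  obtain ⟨s, hs, hsr, hsε⟩ : ∃ s : ℝ, 0 < s ∧ s ≤ r₀ ∧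
      (2 * N + K ^ 2 + 3 * M * K + 1) * s ≤ ε ^ 3 / 48 := by
    have hpos : 0 < 2 * N + K ^ 2 + 3 * M * K + 1 := by positivity
    refine ⟨min r₀ (ε ^ 3 / 48 / (2 * N + K ^ 2 + 3 * M * K + 1)), by positivity,
      min_le_left _ _, ?_⟩
    calc _ ≤ (2 * N + K ^ 2 + 3 * M * K + 1) * (ε ^ 3 / 48 / (2 * N + K ^ 2 + 3 * M * K + 1)) := by
          gcongr; exact min_le_right _ _
      _ = ε ^ 3 / 48 := by field_simp
  refine ⟨ε ^ 2 * s ^ 2 / 6, by positivity, ?_⟩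
  intro W B e lam h δ hδ hδ₀ y hy
  have he := h.norm_eq_one
  rw [mem_ball_zero_iff] at hy
  set X : ℝ := 3 * δ / ε ^ 2 with hX
  have hX0 : 0 < X := by positivity
  have hXδ : X * ε ^ 2 = 3 * δ := by rw [hX]; field_simp
  have hXs : 2 * X ≤ s ^ 2 := by
    have : 2 * X = 6 * δ / ε ^ 2 := by rw [hX]; ring
    rw [this, div_le_iff₀ (by positivity)]; linarith
  have hε3 : ε ^ 3 ≤ 1 := pow_le_one₀ hε.le hε1
  have hMK : 0 ≤ M * K := by positivity
  have hNs : N * s ≤ 1 / 2 := by nlinarith [sq_nonneg K]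
  have hKs : K ^ 2 * s ≤ 1 := by nlinarith
  have hs1 : s ≤ 1 := by nlinarith [sq_nonneg K]
  have hXs' : 2 * X ≤ s := by nlinarith
  have hNX : N * X ≤ 1 / 2 := by nlinarith
  have hKX : K ^ 2 * X ≤ 1 := by nlinarith [sq_nonneg K]
  have hy1 : ‖inner ℂ e y‖ ≤ ‖y‖ := norm_inner_unit_le he y
  set u : ℂ := inner ℂ e y - 1 with hu
  have huε : ε ≤ ‖u‖ := by
    have := norm_sub_norm_le (1 : ℂ) (inner ℂ e y)
    rw [norm_one, norm_sub_rev] at this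
    linarith
  have hu2 : ‖u‖ ≤ 2 := by
    have := norm_sub_le (inner ℂ e y) (1 : ℂ)
    rw [norm_one] at this; linarith
  have hu0 : u ≠ 0 := norm_pos_iff.1 (by linarith)
  have hupos : 0 < ‖u‖ := by linarith
  set ξ : ℂ := δ * (inner ℂ e y + 1) / u with hξ
  set ζ : V := ((√δ : ℝ) / u : ℂ) • tangentialPart e y with hζ
  set x : ℂ := ξ - B ζ ζ with hx
  have hζn : ‖ζ‖ ^ 2 ≤ X / 3 := by
    rw [hζ, norm_smul, norm_div, mul_pow, div_pow, Complex.norm_real, Real.norm_eq_abs, sq_abs,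
      Real.sq_sqrt hδ.le]
    have h1 : ‖tangentialPart e y‖ ≤ 1 := by
      have := norm_tangentialPart_le he y; linarith
    calc δ / ‖u‖ ^ 2 * ‖tangentialPart e y‖ ^ 2 ≤ δ / ε ^ 2 * 1 ^ 2 := by gcongr
      _ = X / 3 := by rw [hX]; ring
  have hBζ : ‖B ζ ζ‖ ≤ X / 3 := (h.norm_quadratic_le ζ).trans
    ((mul_le_of_le_one_left (sq_nonneg _) ha).trans hζn)
  have hξn : ‖ξ‖ ≤ 2 * X / 3 := by
    have h1 : ‖(inner ℂ e y + 1 : ℂ)‖ ≤ 2 := by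
      have := norm_add_le (inner ℂ e y) (1 : ℂ)
      rw [norm_one] at this; linarith
    rw [hξ, norm_div, norm_mul, Complex.norm_real, Real.norm_eq_abs, abs_of_pos hδ]
    calc δ * ‖(inner ℂ e y + 1 : ℂ)‖ / ‖u‖ ≤ δ * 2 / ε ^ 2 := by
          gcongr
          nlinarith
      _ = 2 * X / 3 := by rw [hX]; ring
  have hxn : ‖x‖ ≤ X := by
    have := norm_sub_le ξ (B ζ ζ)
    rw [← hx] at this; linarith
  have hNx : ‖(N : ℂ) * x‖ ≤ N * X := by
    rw [norm_mul, Complex.norm_real, Real.norm_eq_abs, abs_of_pos hN]; gcongr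
  have hmn : ‖1 - N * x‖ ≤ 1 + N * X := by
    have := norm_sub_le (1 : ℂ) (N * x)
    rw [norm_one] at this; linarith
  have hm0 : 1 - N * x ≠ 0 := by
    have := norm_sub_norm_le (1 : ℂ) (N * x)
    rw [norm_one] at this
    exact norm_pos_iff.1 (by linarith)
  obtain ⟨z, z1, z2, z3, z4, z5, z6⟩ := modelMap_preimage B he h.lam_pos.ne' hδ hu hu0 hξ hζ hx hm0
  refine ⟨z, ?_, z6⟩
  have hi : ‖inner ℂ e z‖ ≤ K * X := by
    refine (h.norm_inner_le z).trans ?_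
    rw [z1]; gcongr
  have hcp : (1 - N * x) ^ (1 / 2 : ℂ) * (1 - N * x) ^ (1 / 2 : ℂ) = 1 - N * x := by
    rw [← Complex.cpow_add _ _ hm0]; norm_num
  have hw : ‖tangentialPart e z‖ ^ 2 = ‖1 - N * x‖ * ‖ζ‖ ^ 2 := by
    rw [z2, norm_smul, mul_pow, sq ‖_ ^ _‖, ← norm_mul, hcp]
  have hBw : B (tangentialPart e z) (tangentialPart e z) = B ζ ζ - N * x * B ζ ζ := by
    rw [z2]
    simp only [map_smul, _root_.smul_apply, smul_eq_mul]
    rw [← mul_assoc, hcp]; ring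
  have hpyth := norm_sq_eq_tangentialPart he z
  have hi2 : ‖inner ℂ e z‖ ^ 2 ≤ K ^ 2 * X * X := by
    calc ‖inner ℂ e z‖ ^ 2 ≤ (K * X) ^ 2 := by gcongr
      _ = K ^ 2 * X * X := by ring
  have hw2 : ‖tangentialPart e z‖ ^ 2 ≤ ‖ζ‖ ^ 2 + N * X * X := by
    have h1 : ‖1 - N * x‖ * ‖ζ‖ ^ 2 ≤ (1 + N * X) * ‖ζ‖ ^ 2 := by gcongr
    have h2 : N * X * ‖ζ‖ ^ 2 ≤ N * X * X := by gcongr; linarith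
    rw [hw]; linarith
  have hz2 : ‖z‖ ^ 2 ≤ 2 * X := by
    have h1 : K ^ 2 * X * X ≤ 1 * X := by gcongr
    have h2 : N * X * X ≤ 1 / 2 * X := by gcongr
    linarith
  have hzs : ‖z‖ ≤ s := le_of_sq_le_sq (hz2.trans hXs) hs.le
  refine h.mem z (hzs.trans hsr) ?_
  have hquad := norm_quadratic_sub_tangentialPart_le B h.norm_le he z
  have hre := Complex.re_le_norm (B z z - B (tangentialPart e z) (tangentialPart e z))
  rw [hBw, Complex.sub_re, Complex.sub_re] at hre
  rw [hBw] at hquad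
  have hNB : -((N * x * B ζ ζ).re) ≤ N * X * X := by
    refine (neg_le_abs _).trans ((Complex.abs_re_le_norm _).trans ?_)
    rw [norm_mul]
    gcongr
    linarith
  have hcube : 3 * M * ‖inner ℂ e z‖ * ‖z‖ ≤ 3 * M * (K * X) * s := by gcongr
  have hηz : η * ‖z‖ ^ 2 ≤ ε ^ 3 / 48 * (2 * X) := by gcongr
  have hxre : x.re = ξ.re - (B ζ ζ).re := by rw [hx, Complex.sub_re]
  have hmain : ξ.re + ‖ζ‖ ^ 2 ≤ -(ε ^ 3 * X / 12) := by
    have hne : shearedHeight B e lam N z - δ ≠ 0 := by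
      rw [z4, z5]
      exact div_ne_zero (mul_ne_zero two_ne_zero (by exact_mod_cast hδ.ne')) hu0
    have h1 := norm_sq_modelMap B he hδ hne
    have h2 : ‖(2 * δ / u : ℂ)‖ ^ 2 = 4 * δ ^ 2 / ‖u‖ ^ 2 := by
      rw [norm_div, norm_mul, Complex.norm_real, Real.norm_eq_abs, abs_of_pos hδ]
      norm_num; ring
    rw [z6, z4, z3, z5, h2] at h1
    have h3 : ‖y‖ ^ 2 - 1 = ‖u‖ ^ 2 / δ * (ξ.re + ‖ζ‖ ^ 2) := by
      rw [h1]; field_simp; ring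
    have h4 : ‖y‖ ^ 2 - 1 ≤ -ε := by nlinarith [norm_nonneg y]
    have h5 : ξ.re + ‖ζ‖ ^ 2 = (‖y‖ ^ 2 - 1) * (δ / ‖u‖ ^ 2) := by
      rw [h3]; field_simp
    have h6 : δ / 2 ^ 2 ≤ δ / ‖u‖ ^ 2 := by gcongr
    have h7 : (‖y‖ ^ 2 - 1) * (δ / ‖u‖ ^ 2) ≤ -ε * (δ / ‖u‖ ^ 2) := by gcongr
    have h8 : ε * (δ / 2 ^ 2) ≤ ε * (δ / ‖u‖ ^ 2) := by gcongr
    have h9 : ε ^ 3 * X = ε * (3 * δ) := by rw [← hXδ]; ring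
    rw [h5, h9]; linarith
  rw [z1]
  have hfin : (2 * N + K ^ 2 + 3 * M * K + 1) * s * X ≤ ε ^ 3 / 48 * X := by gcongr
  have hXX : (2 * N + K ^ 2) * X * X ≤ (2 * N + K ^ 2) * s * X := by
    gcongr; linarith
  have hpos : 0 < ε ^ 3 * X := by positivity
  have hsX : 0 < s * X := by positivity
  linarith

/-- If the ball `B(q, ‖x - q‖)` lies in the half-space `Re ⟪g, z - x⟫ ≤ 0`, then `x - q` is a
nonnegative multiple of `g`. -/
lemma sub_eq_smul_of_ball_subset_halfspace {g x q : V} (hg : g ≠ 0)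
    (h : ∀ z ∈ ball q ‖x - q‖, (inner ℂ g (z - x)).re ≤ 0) :
    x - q = (‖x - q‖ : ℂ) • ((‖g‖⁻¹ : ℂ) • g) := by
  have hgn : 0 < ‖g‖ := norm_pos_iff.2 hg
  set d := ‖x - q‖ with hd
  set e : V := (‖g‖⁻¹ : ℂ) • g with he
  have hen : ‖e‖ = 1 := by
    rw [he, norm_smul, norm_inv, Complex.norm_real, norm_norm, inv_mul_cancel₀ hgn.ne']
  have hge : (inner ℂ g e).re = ‖g‖ := by
    rw [he, inner_smul_right, inner_self_eq_norm_sq_to_K, ← Complex.ofReal_inv,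
      Complex.re_ofReal_mul]
    simp only [Complex.coe_algebraMap, ← Complex.ofReal_pow, Complex.ofReal_re]
    field_simp
  rcases (norm_nonneg (x - q)).eq_or_lt with h0 | h0
  · rw [← hd] at h0
    rw [← h0]; simpa using (norm_eq_zero.1 (hd.symm.trans h0.symm))
  have key : d * ‖g‖ ≤ (inner ℂ g (x - q)).re := by
    have hP : 0 < d * ‖g‖ := mul_pos h0 hgn
    suffices hs : ∀ s < 1, s * (d * ‖g‖) ≤ (inner ℂ g (x - q)).re by
      by_contra! hcon
      have h1 := hs (((inner ℂ g (x - q)).re / (d * ‖g‖) + 1) / 2) (by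
        rw [div_lt_one two_pos]
        linarith [(div_lt_one hP).2 hcon])
      have h2 : (((inner ℂ g (x - q)).re / (d * ‖g‖) + 1) / 2) * (d * ‖g‖)
          = ((inner ℂ g (x - q)).re + d * ‖g‖) / 2 := by
        rw [div_mul_eq_mul_div, add_mul, div_mul_cancel₀ _ hP.ne', one_mul]
      linarith
    intro s hs
    rcases le_or_gt s 0 with hs0 | hs0
    · have := h q (mem_ball_self h0)
      rw [← neg_sub x q, inner_neg_right, Complex.neg_re] at this
      nlinarith [mul_pos h0 hgn]
    have hz : q + ((s * d : ℝ) : ℂ) • e ∈ ball q d := by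
      rw [mem_ball_iff_norm, add_sub_cancel_left, norm_smul, hen, Complex.norm_real,
        Real.norm_eq_abs, abs_of_pos (by positivity), mul_one]
      nlinarith
    have h2 := h _ hz
    have h3 : q + ((s * d : ℝ) : ℂ) • e - x = ((s * d : ℝ) : ℂ) • e - (x - q) := by abel
    rw [h3, inner_sub_right, inner_smul_right, Complex.sub_re, Complex.re_ofReal_mul, hge] at h2
    linarith
  have h1 : (inner ℂ (x - q) e).re = ‖g‖⁻¹ * (inner ℂ g (x - q)).re := by
    rw [he, inner_smul_right, ← Complex.ofReal_inv, Complex.re_ofReal_mul]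
    congr 1
    exact inner_re_symm (𝕜 := ℂ) _ _
  have h2 : d ≤ (inner ℂ (x - q) e).re := by
    rw [h1, ← div_eq_inv_mul, le_div_iff₀ hgn]; exact key
  have h3 : ‖x - q - (d : ℂ) • e‖ ^ 2 ≤ 0 := by
    have := norm_sub_sq (𝕜 := ℂ) (x - q) ((d : ℂ) • e)
    rw [this, inner_smul_right, norm_smul, hen, Complex.norm_real, Real.norm_eq_abs,
      abs_of_pos h0]
    simp only [RCLike.re_to_complex, Complex.re_ofReal_mul]
    rw [← hd]
    nlinarith
  have h4 : ‖x - q - (d : ℂ) • e‖ = 0 := by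
    have := sq_nonneg ‖x - q - (d : ℂ) • e‖
    exact pow_eq_zero_iff two_ne_zero |>.1 (le_antisymm h3 this)
  exact sub_eq_zero.1 (norm_eq_zero.1 h4)

/-- A nearest point of the complement of an open set lies on the frontier. -/
lemma exists_nearest_frontier_point [ProperSpace V] {Ω : Set V} (hopen : IsOpen Ω) {p q : V}
    (hp : p ∈ frontier Ω) (hq : q ∈ Ω) :
    ∃ x ∈ frontier Ω, 0 < ‖x - q‖ ∧ ‖x - q‖ ≤ ‖q - p‖ ∧ ball q ‖x - q‖ ⊆ Ω := by
  have hpc : p ∈ Ωᶜ := by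
    rw [hopen.frontier_eq] at hp; exact hp.2
  obtain ⟨x, hx, hd⟩ := (hopen.isClosed_compl).exists_infDist_eq_dist ⟨p, hpc⟩ q
  have hxq : ‖x - q‖ = dist q x := by rw [dist_comm, dist_eq_norm]
  have hxq0 : 0 < ‖x - q‖ := by
    rw [norm_pos_iff, sub_ne_zero]; rintro rfl; exact hx hq
  have hball : ball q ‖x - q‖ ⊆ Ω := by
    intro z hz
    by_contra hcon
    have := infDist_le_dist_of_mem (x := q) (show z ∈ Ωᶜ from hcon)
    rw [hd, ← hxq, dist_comm] at this
    exact absurd (mem_ball.1 hz) (not_lt.2 this)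
  refine ⟨x, ?_, hxq0, ?_, hball⟩
  · rw [hopen.frontier_eq]
    refine ⟨closure_mono hball ?_, hx⟩
    rw [closure_ball q hxq0.ne', mem_closedBall, dist_eq_norm]
  · rw [hxq, ← hd, ← dist_eq_norm]
    exact infDist_le_dist_of_mem hpc

/-- The strict support property at `p` is uniform away from the contact point, also for frontier
points close to `p`. -/
lemma exists_uniform_support [ProperSpace V] {Ω : Set V} (hbdd : Bornology.IsBounded Ω) {p : V}
    {G : V → V} (hG : ContinuousAt G p)
    (hstrict : ∀ z ∈ closure Ω, z ≠ p → (inner ℂ (G p) (z - p)).re < 0) {r₀ : ℝ} (hr₀ : 0 < r₀) :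
    ∃ c₁ > 0, ∃ r > 0, ∀ x ∈ ball p r, ∀ z ∈ Ω, r₀ ≤ ‖z - x‖ →
      c₁ ≤ -(inner ℂ (G x) (z - x)).re := by
  have hK : IsCompact (closure Ω \ ball p (r₀ / 2)) :=
    hbdd.isCompact_closure.diff isOpen_ball
  have hcont : Continuous (fun y : V × V => -(inner ℂ y.1 y.2).re) := by fun_prop
  obtain ⟨c₁, hc₁, h1⟩ : ∃ c₁ > 0, ∀ z ∈ closure Ω \ ball p (r₀ / 2),
      2 * c₁ ≤ -(inner ℂ (G p) (z - p)).re := by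
    rcases (closure Ω \ ball p (r₀ / 2)).eq_empty_or_nonempty with hempty | hne
    · exact ⟨1, one_pos, fun z hz => by rw [hempty] at hz; exact hz.elim⟩
    · obtain ⟨z₀, hz₀, hmin⟩ := hK.exists_isMinOn hne
        (f := fun z => -(inner ℂ (G p) (z - p)).re) (by fun_prop)
      have hz₀p : z₀ ≠ p := by
        rintro rfl; exact hz₀.2 (mem_ball_self (by positivity))
      have := hstrict z₀ hz₀.1 hz₀p
      refine ⟨-(inner ℂ (G p) (z₀ - p)).re / 2, by linarith, fun z hz => ?_⟩
      have h2 := hmin hz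
      simp only [mem_ofPred_eq] at h2
      linarith
  obtain ⟨D, hD⟩ := hbdd.subset_closedBall p
  have hDΩ : ∀ z ∈ Ω, ‖z - p‖ ≤ |D| := fun z hz => by
    rw [← dist_eq_norm]; exact (mem_closedBall.1 (hD hz)).trans (le_abs_self D)
  have hsmall : ∀ᶠ x in nhds p, ‖G x - G p‖ * (|D| + 1) + ‖G p‖ * ‖x - p‖ < c₁ := by
    have : ContinuousAt (fun x => ‖G x - G p‖ * (|D| + 1) + ‖G p‖ * ‖x - p‖) p := by fun_prop
    refine this.eventually_lt_const ?_
    simpa using hc₁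
  obtain ⟨r, hr, hball⟩ := Metric.eventually_nhds_iff_ball.1 hsmall
  refine ⟨c₁, hc₁, min r (min 1 (r₀ / 2)), by positivity, ?_⟩
  intro x hx z hz hzx
  have hx1 : x ∈ ball p r := ball_subset_ball (min_le_left _ _) hx
  have hx2 : ‖x - p‖ < min 1 (r₀ / 2) := by
    rw [← dist_eq_norm]; exact (mem_ball.1 hx).trans_le (min_le_right _ _)
  have hx3 := hx2.trans_le (min_le_left _ _)
  have hx4 := hx2.trans_le (min_le_right _ _)
  have htri : ‖z - x‖ ≤ ‖z - p‖ + ‖x - p‖ := by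
    have : z - x = (z - p) - (x - p) := by abel
    rw [this]; exact norm_sub_le _ _
  have hzK : z ∈ closure Ω \ ball p (r₀ / 2) := by
    refine ⟨subset_closure hz, fun hcon => ?_⟩
    rw [mem_ball, dist_eq_norm] at hcon
    linarith
  have h2 := h1 z hzK
  have h3 : inner ℂ (G x) (z - x)
      = inner ℂ (G p) (z - p) + (inner ℂ (G x - G p) (z - x) - inner ℂ (G p) (x - p)) := by
    simp only [inner_sub_left, inner_sub_right]; ring
  have h4 : (inner ℂ (G x - G p) (z - x)).re ≤ ‖G x - G p‖ * (|D| + 1) := by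
    refine (Complex.re_le_norm _).trans ((norm_inner_le_norm _ _).trans ?_)
    gcongr
    have := hDΩ z hz
    linarith
  have h5 : -(inner ℂ (G p) (x - p)).re ≤ ‖G p‖ * ‖x - p‖ :=
    (neg_le_abs _).trans ((Complex.abs_re_le_norm _).trans (norm_inner_le_norm _ _))
  have h6 := hball x hx1
  rw [h3, Complex.add_re, Complex.sub_re]
  linarith

/-- Near a boundary point where the defining function is `Re B(z, z) + ‖z‖²` to second order, with
`B` of size less than one, the domain maps biholomorphically almost onto the unit ball. -/
theorem exists_almost_ball_map [ProperSpace V] {Ω : Set V} (hopen : IsOpen Ω)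
    (hbdd : Bornology.IsBounded Ω) {σ : V → ℝ} (hΩ : Ω = {x | σ x < 0})
    (hfr : ∀ x ∈ frontier Ω, σ x = 0) {p : V} (hp : p ∈ frontier Ω) {G : V → V}
    (hG : ContinuousAt G p) (hGp : G p ≠ 0)
    (hsupp : ∀ x ∈ frontier Ω, ∀ z ∈ Ω, (inner ℂ (G x) (z - x)).re ≤ 0)
    (hstrict : ∀ z ∈ closure Ω, z ≠ p → (inner ℂ (G p) (z - p)).re < 0)
    {B : V →L[ℂ] V →L[ℂ] ℂ}
    (hT : ∀ η > 0, ∃ r > 0, ∀ x ∈ ball p r, ∀ z, ‖z‖ ≤ r →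
      |σ (x + z) - σ x - (inner ℂ (G x) z).re - ((B z z).re + ‖z‖ ^ 2)| ≤ η * ‖z‖ ^ 2)
    {a : ℝ} (ha : a < 1) (hB : ∀ z, ‖B z z‖ ≤ a * ‖z‖ ^ 2) {ε : ℝ} (hε : 0 < ε) (hε1 : ε ≤ 1) :
    ∃ r > 0, ∀ q ∈ Ω ∩ ball p r, ∃ f : V → V, DifferentiableOn ℂ f Ω ∧ InjOn f Ω ∧
      f '' Ω ⊆ ball 0 (1 + ε) ∧ f q = 0 ∧ ball 0 (1 - ε) ⊆ f '' Ω := by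
  have hgp : 0 < ‖G p‖ := norm_pos_iff.2 hGp
  have ha0 : 0 ≤ a := by
    have := (norm_nonneg _).trans (hB (G p))
    by_contra hcon
    nlinarith [sq_pos_of_pos hgp]
  obtain ⟨c, hc⟩ : ∃ c, c = (1 - a) / 2 := ⟨_, rfl⟩
  have hc0 : 0 < c := by linarith
  have hc1 : c ≤ 1 := by linarith
  obtain ⟨η, hη0, hη1, hη2, hη3⟩ : ∃ η > 0, η ≤ c ∧ η ≤ c * ε / 24 ∧ η ≤ ε ^ 3 / 48 :=
    ⟨min c (min (c * ε / 24) (ε ^ 3 / 48)), by positivity, min_le_left _ _,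
      (min_le_right _ _).trans (min_le_left _ _), (min_le_right _ _).trans (min_le_right _ _)⟩
  obtain ⟨r, hr, htaylor⟩ := hT η hη0
  obtain ⟨K, hK⟩ : ∃ K, K = 2 / ‖G p‖ := ⟨_, rfl⟩
  have hK0 : 0 < K := by rw [hK]; positivity
  obtain ⟨M, hM⟩ : ∃ M, M = ‖B‖ := ⟨_, rfl⟩
  have hM0 : 0 ≤ M := by rw [hM]; positivity
  obtain ⟨r₀, hr₀, hr₀r, hr₀1, hr₀2⟩ : ∃ r₀ > 0, r₀ ≤ r ∧ 3 * M * K * r₀ ≤ c / 4 ∧ K * r₀ ≤ 1 := by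
    refine ⟨min r (min (c / 4 / (3 * M * K + 1)) (1 / K)), by positivity, min_le_left _ _, ?_, ?_⟩
    · have h1 : min r (min (c / 4 / (3 * M * K + 1)) (1 / K)) ≤ c / 4 / (3 * M * K + 1) :=
        (min_le_right _ _).trans (min_le_left _ _)
      have h0 : 0 < min r (min (c / 4 / (3 * M * K + 1)) (1 / K)) := by positivity
      rw [le_div_iff₀ (by positivity)] at h1
      linarith
    · have h1 : min r (min (c / 4 / (3 * M * K + 1)) (1 / K)) ≤ 1 / K :=
        (min_le_right _ _).trans (min_le_right _ _)
      rw [le_div_iff₀ hK0] at h1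
      linarith
  obtain ⟨c₁, hc₁, r₂, hr₂, hfar⟩ := exists_uniform_support hbdd hG hstrict hr₀
  obtain ⟨D', hD'⟩ := hbdd.subset_closedBall p
  obtain ⟨D, hD⟩ : ∃ D, D = |D'| + 1 := ⟨_, rfl⟩
  have hD0 : 0 < D := by rw [hD]; positivity
  obtain ⟨N, hN, δ₁, hδ₁, houter⟩ := exists_modelMap_outer (V := V) hε hM0 hK0.le hD0 hc₁ ha.le
    (hη1.trans hc1) hc0 hc1 (by linarith) hr₀1 hr₀2 hη2
  obtain ⟨δ₂, hδ₂, hinner⟩ := exists_modelMap_inner (V := V) (D := D) (c₁ := c₁) hε hε1 hM0 hK0.le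
    hr₀ ha.le hη0.le hη3 hN
  have hnear : ∀ᶠ x in nhds p, ‖G p‖ / 2 < ‖G x‖ ∧ ‖G x‖ < 2 * ‖G p‖ :=
    (hG.norm.eventually_const_lt (by linarith)).and (hG.norm.eventually_lt_const (by linarith))
  obtain ⟨r₃, hr₃, hball⟩ := Metric.eventually_nhds_iff_ball.1 hnear
  obtain ⟨s, hs, hs1, hs2, hs3, hs4⟩ : ∃ s > 0, s ≤ r ∧ s ≤ r₂ ∧ s ≤ r₃ ∧ s ≤ 1 :=
    ⟨min (min r r₂) (min r₃ 1), by positivity, (min_le_left _ _).trans (min_le_left _ _),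
      (min_le_left _ _).trans (min_le_right _ _), (min_le_right _ _).trans (min_le_left _ _),
      (min_le_right _ _).trans (min_le_right _ _)⟩
  refine ⟨min (s / 2) (min δ₁ δ₂ / (2 * ‖G p‖)), by positivity, ?_⟩
  rintro q ⟨hq, hqp⟩
  rw [mem_ball, dist_eq_norm, lt_min_iff] at hqp
  obtain ⟨x, hx, hd0, hd1, hballΩ⟩ := exists_nearest_frontier_point hopen hp hq
  have hxs : x ∈ ball p s := by
    rw [mem_ball, dist_eq_norm]
    have : x - p = (x - q) + (q - p) := by abel
    rw [this]
    refine (norm_add_le _ _).trans_lt ?_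
    linarith [hqp.1]
  obtain ⟨hg1, hg2⟩ := hball x (ball_subset_ball hs3 hxs)
  have hlam : 0 < ‖G x‖ := by linarith
  set e : V := (‖G x‖⁻¹ : ℂ) • G x with he
  have hheight : ∀ z, height e ‖G x‖ z = inner ℂ (G x) z := by
    intro z
    have : (‖G x‖ : ℂ) ≠ 0 := by exact_mod_cast hlam.ne'
    rw [height, he, inner_smul_left, ← Complex.ofReal_inv, Complex.conj_ofReal,
      Complex.ofReal_inv]
    field_simp
  have hxq := sub_eq_smul_of_ball_subset_halfspace (norm_pos_iff.1 hlam)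
    (fun z hz => hsupp x hx z (hballΩ hz))
  rw [← he] at hxq
  have hσx := hfr x hx
  have hW : IsNearlyQuadratic ((fun z => x + z) ⁻¹' Ω) B e ‖G x‖ a M K D c₁ r₀ η :=
    { norm_eq_one := by
        rw [he, norm_smul, norm_inv, Complex.norm_real, norm_norm, inv_mul_cancel₀ hlam.ne']
      lam_pos := hlam
      inv_le := by
        rw [hK, inv_le_comm₀ hlam (by positivity), inv_div]; exact hg1.le
      norm_quadratic_le := hB
      norm_le := hM.ge
      bounded := fun z hz => by
        have h1 : ‖x + z - p‖ ≤ |D'| := by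
          rw [← dist_eq_norm]; exact (mem_closedBall.1 (hD' hz)).trans (le_abs_self _)
        have h2 : ‖x - p‖ < 1 := by
          rw [← dist_eq_norm]; exact (mem_ball.1 hxs).trans_le hs4
        have h3 : z = (x + z - p) - (x - p) := by abel
        rw [h3, hD]
        exact (norm_sub_le _ _).trans (by linarith)
      re_nonpos := fun z hz => by
        rw [hheight]; simpa using hsupp x hx _ hz
      far := fun z hz hzr => by
        have h1 := hfar x (ball_subset_ball hs2 hxs) _ hz (by simpa using hzr)
        rw [add_sub_cancel_left] at h1
        rw [hheight]
        exact h1.trans ((neg_le_abs _).trans (Complex.abs_re_le_norm _))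
      near := fun z hz hzr => by
        have h1 := htaylor x (ball_subset_ball hs1 hxs) z (hzr.trans hr₀r)
        have h2 : σ (x + z) < 0 := by
          have : x + z ∈ Ω := hz
          rwa [hΩ] at this
        have h3 := (abs_le.1 h1).1
        rw [hheight]; linarith
      mem := fun z hzr hz => by
        have h1 := htaylor x (ball_subset_ball hs1 hxs) z (hzr.trans hr₀r)
        have h3 := (abs_le.1 h1).2
        rw [hheight] at hz
        change x + z ∈ Ω
        rw [hΩ]
        change σ (x + z) < 0
        linarith }
  obtain ⟨δ, hδ⟩ : ∃ δ, δ = ‖G x‖ * ‖x - q‖ := ⟨_, rfl⟩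
  have hδ0 : 0 < δ := by rw [hδ]; positivity
  have hδm : δ < min δ₁ δ₂ := by
    refine lt_of_le_of_lt ?_ ((lt_div_iff₀ (by positivity)).1 hqp.2)
    calc δ ≤ (2 * ‖G p‖) * ‖q - p‖ := by rw [hδ]; gcongr
      _ = _ := mul_comm _ _
  have hout := houter _ B e ‖G x‖ hW δ hδ0 (hδm.trans_le (min_le_left _ _))
  have hin := hinner _ B e ‖G x‖ hW δ hδ0 (hδm.trans_le (min_le_right _ _))
  have hmre : ∀ z ∈ (fun z => x + z) ⁻¹' Ω, 0 < (1 - N * height e ‖G x‖ z).re := fun z hz =>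
    (cutoff_bounds hN (hW.re_nonpos z hz)).1
  have hm0 : ∀ z ∈ (fun z => x + z) ⁻¹' Ω, 1 - N * height e ‖G x‖ z ≠ 0 := fun z hz h0 => by
    have := hmre z hz; rw [h0] at this; simp at this
  have hmaps : MapsTo (fun w => w - x) Ω ((fun z => x + z) ⁻¹' Ω) := fun w hw => by
    simpa using hw
  refine ⟨fun w => modelMap B e ‖G x‖ N δ (w - x), ?_, ?_, ?_, ?_, ?_⟩
  · exact (differentiableOn_modelMap B e ‖G x‖ N δ hmre fun z hz => (hout z hz).1).comp
      (by fun_prop) hmaps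
  · exact (injOn_modelMap B hW.norm_eq_one hlam.ne' hδ0 hm0 fun z hz => (hout z hz).1).comp
      (sub_left_injective.injOn) hmaps
  · rintro _ ⟨w, hw, rfl⟩
    rw [mem_ball_zero_iff]
    have := (hout _ (hmaps hw)).2
    exact lt_of_pow_lt_pow_left₀ 2 (by positivity) (by nlinarith)
  · have h1 : q - x = -((δ / ‖G x‖ : ℝ) : ℂ) • e := by
      rw [hδ, mul_div_cancel_left₀ _ hlam.ne', neg_smul, ← hxq]; abel
    change modelMap B e ‖G x‖ N δ (q - x) = 0
    rw [h1]
    exact modelMap_center B hW.norm_eq_one hlam.ne'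
  · intro y hy
    obtain ⟨z, hz, hzy⟩ := hin hy
    exact ⟨x + z, hz, by simpa using hzy⟩

end ModelMap

section StronglyConvex

section Real

variable {W : Type*} [NormedAddCommGroup W] [NormedSpace ℝ W]

/-- Second order Taylor expansion of a `C²` function, uniform in the base point near `p`, with the
Hessian frozen at `p`. -/
lemma exists_uniform_taylor {ρ : W → ℝ} (hρ : ContDiff ℝ 2 ρ) (p : W) {η : ℝ} (hη : 0 < η) :
    ∃ r > 0, ∀ x ∈ ball p r, ∀ w, ‖w‖ ≤ r →
      |ρ (x + w) - ρ x - fderiv ℝ ρ x w - fderiv ℝ (fderiv ℝ ρ) p w w / 2| ≤ η * ‖w‖ ^ 2 := by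
  set H := fderiv ℝ (fderiv ℝ ρ) p with hH
  have hsymm : ∀ v w, H v w = H w v := fun v w =>
    (hρ.contDiffAt.isSymmSndFDerivAt (by simp) : IsSymmSndFDerivAt ℝ ρ p) v w
  have hd : Differentiable ℝ ρ := hρ.differentiable (by norm_num)
  have hC1 : ContDiff ℝ 1 (fderiv ℝ ρ) := hρ.fderiv_right (by norm_num)
  have hstrict : HasStrictFDerivAt (fderiv ℝ ρ) H p :=
    hC1.contDiffAt.hasStrictFDerivAt (by norm_num)
  have hev := hstrict.isLittleO.def hη
  rw [Metric.eventually_nhds_iff_ball] at hev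
  obtain ⟨r, hr, hev⟩ := hev
  refine ⟨r / 2, by positivity, fun x hx w hw => ?_⟩
  have hxr : x ∈ ball p r := ball_subset_ball (by linarith) hx
  have hsub : ∀ y ∈ closedBall x ‖w‖, y ∈ ball p r := fun y hy => by
    rw [mem_ball] at hx ⊢
    rw [mem_closedBall] at hy
    linarith [dist_triangle y x p]
  have hk : ∀ y ∈ closedBall x ‖w‖, HasFDerivWithinAt
      (fun y => ρ y - H (y - x) (y - x) / 2) (fderiv ℝ ρ y - H (y - x)) (closedBall x ‖w‖) y := by
    intro y _
    have h1 : HasFDerivAt (fun y => y - x) (ContinuousLinearMap.id ℝ W) y :=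
      (hasFDerivAt_id y).sub_const x
    have h2 := (H.hasFDerivAt.comp y h1).clm_apply h1
    have h3 := (hd y).hasFDerivAt.sub (h2.mul_const (1 / 2 : ℝ))
    refine (HasFDerivAt.congr_fderiv (h3.congr_of_eventuallyEq ?_) ?_).hasFDerivWithinAt
    · exact Filter.Eventually.of_forall fun z => by simp [div_eq_mul_inv]
    · ext v
      have h4 : H v (y - x) = H (y - x) v := hsymm _ _
      simp only [one_div, Function.comp_apply, ContinuousLinearMap.comp_id, _root_.sub_apply,
        _root_.smul_apply, _root_.add_apply, ContinuousLinearMap.flip_apply, h4, smul_eq_mul]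
      ring
  have hbound : ∀ y ∈ closedBall x ‖w‖, ‖fderiv ℝ ρ y - H (y - x) - fderiv ℝ ρ x‖ ≤ η * ‖w‖ := by
    intro y hy
    have h1 := hev (y, x) (by
      rw [← ball_prod_same]; exact ⟨hsub y hy, hxr⟩)
    rw [sub_right_comm]
    refine h1.trans ?_
    have : ‖y - x‖ ≤ ‖w‖ := by rwa [← dist_eq_norm]
    gcongr
  have hfin := Convex.norm_image_sub_le_of_norm_hasFDerivWithin_le' hk hbound
    (convex_closedBall x ‖w‖) (mem_closedBall_self (norm_nonneg w))
    (show x + w ∈ closedBall x ‖w‖ by simp)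
  simp only [add_sub_cancel_left, sub_self, map_zero, zero_div, sub_zero, Real.norm_eq_abs] at hfin
  calc _ = |ρ (x + w) - H w w / 2 - ρ x - fderiv ℝ ρ x w| := by congr 1; ring
    _ ≤ _ := hfin
    _ = _ := by ring

/-- Along a direction in which the first derivative vanishes and the Hessian is positive, a `C²`
function increases strictly. -/
lemma lt_of_fderiv_eq_zero_of_hessian_pos {ρ : W → ℝ} (hρ : ContDiff ℝ 2 ρ) {x v : W}
    (hv : 0 < iteratedFDeriv ℝ 2 ρ x ![v, v]) (hD : fderiv ℝ ρ x v = 0) :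
    ∀ᶠ t in nhdsWithin (0 : ℝ) (Ioi 0), ρ x < ρ (x + t • v) := by
  rw [iteratedFDeriv_two_apply] at hv
  simp only [Matrix.cons_val_zero, Matrix.cons_val_one] at hv
  obtain ⟨r, hr, h⟩ := exists_uniform_taylor hρ x
    (η := fderiv ℝ (fderiv ℝ ρ) x v v / (4 * (‖v‖ ^ 2 + 1))) (by positivity)
  have hsmall : ∀ᶠ t in nhdsWithin (0 : ℝ) (Ioi 0), ‖t • v‖ < r := by
    have hc : ContinuousAt (fun t : ℝ => ‖t • v‖) 0 := by fun_prop
    exact (hc.eventually_lt_const (by simpa using hr)).filter_mono nhdsWithin_le_nhds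
  filter_upwards [hsmall, self_mem_nhdsWithin] with t ht ht0
  have ht0 : 0 < t := ht0
  have h1 := (abs_le.1 (h x (mem_ball_self hr) (t • v) ht.le)).1
  simp only [map_smul, hD, smul_eq_mul, mul_zero, norm_smul, Real.norm_eq_abs, abs_of_pos ht0,
    _root_.smul_apply] at h1
  have h2 : fderiv ℝ (fderiv ℝ ρ) x v v / (4 * (‖v‖ ^ 2 + 1)) * (t * ‖v‖) ^ 2
      ≤ t ^ 2 * (fderiv ℝ (fderiv ℝ ρ) x v v / 4) := by
    rw [div_mul_eq_mul_div, div_le_iff₀ (by positivity)]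
    nlinarith [mul_pos hv (sq_pos_of_pos ht0)]
  nlinarith [mul_pos hv (sq_pos_of_pos ht0)]

/-- A connected sublevel set whose defining function has positive definite Hessian on the boundary
is convex. -/
lemma convex_of_hessian_pos {Ω : Set W} (hopen : IsOpen Ω) (hconn : IsPreconnected Ω)
    {ρ : W → ℝ} (hρ : ContDiff ℝ 2 ρ) (hΩ : Ω = {x | ρ x < 0}) (hbd : frontier Ω = {x | ρ x = 0})
    (hhess : ∀ x ∈ frontier Ω, ∀ v, v ≠ 0 → 0 < iteratedFDeriv ℝ 2 ρ x ![v, v]) :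
    Convex ℝ Ω := by
  have hc : Continuous ρ := hρ.continuous
  rw [convex_iff_segment_subset]
  intro x hx
  let S : Set W := {y | ∀ t ∈ Icc (0 : ℝ) 1, x + t • (y - x) ∈ Ω}
  suffices h : Ω ⊆ S by
    intro y hy
    rw [segment_eq_image']
    rintro _ ⟨t, ht, rfl⟩
    exact h hy t ht
  refine hconn.subset_of_closure_inter_subset ?_ ⟨x, hx, by simp [S, hx]⟩ ?_
  · rw [isOpen_iff_eventually]
    intro y hy
    refine isCompact_Icc.eventually_forall_of_forall_eventually fun t ht => ?_
    have : Continuous fun z : W × ℝ => x + z.2 • (z.1 - x) := by fun_prop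
    exact (hopen.preimage this).mem_nhds (hy t ht)
  · rintro y ⟨hy, hyΩ⟩ t ht
    have hle : ∀ s ∈ Icc (0 : ℝ) 1, ρ (x + s • (y - x)) ≤ 0 := by
      intro s hs
      have hcl : IsClosed {y | ρ (x + s • (y - x)) ≤ 0} :=
        isClosed_le (by fun_prop) continuous_const
      refine closure_minimal (fun z hz => ?_) hcl hy
      have h : ρ (x + s • (z - x)) < 0 := by simpa [hΩ] using hz s hs
      exact h.le
    by_contra hcon
    have hm0 : ρ (x + t • (y - x)) = 0 := by
      refine le_antisymm (hle t ht) (not_lt.1 fun h => hcon ?_)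
      rw [hΩ]; exact h
    have ht0 : 0 < t := ht.1.lt_of_ne' fun h => hcon (by simpa [h] using hx)
    have ht1 : t < 1 := ht.2.lt_of_ne fun h => hcon (by simpa [h] using hyΩ)
    have hv : y - x ≠ 0 := fun h => hcon (by simpa [h] using hx)
    have hmf : x + t • (y - x) ∈ frontier Ω := by rw [hbd]; exact hm0
    have hline : HasDerivAt (fun s : ℝ => ρ (x + s • (y - x)))
        (fderiv ℝ ρ (x + t • (y - x)) (y - x)) t := by
      have h1 : HasDerivAt (fun s : ℝ => x + s • (y - x)) (y - x) t := by
        simpa using ((hasDerivAt_id t).smul_const (y - x)).const_add x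
      exact ((hρ.differentiable (by norm_num)) _).hasFDerivAt.comp_hasDerivAt t h1
    have hmax : IsLocalMax (fun s : ℝ => ρ (x + s • (y - x))) t := by
      filter_upwards [Icc_mem_nhds ht0 ht1] with s hs
      rw [hm0]; exact hle s hs
    have hpos := lt_of_fderiv_eq_zero_of_hessian_pos hρ (hhess _ hmf _ hv)
      (hmax.hasDerivAt_eq_zero hline)
    have hev : ∀ᶠ s in nhdsWithin (0 : ℝ) (Ioi 0), s < 1 - t :=
      (eventually_lt_nhds (by linarith)).filter_mono nhdsWithin_le_nhds
    obtain ⟨s, ⟨hs1, hs2⟩, hs3⟩ := ((hpos.and hev).and self_mem_nhdsWithin).exists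
    have hs3 : 0 < s := hs3
    rw [hm0, add_assoc, ← add_smul] at hs1
    exact absurd (hle (t + s) ⟨by linarith, by linarith⟩) (not_le.2 hs1)

/-- The tangent hyperplane at a boundary point is a strictly supporting hyperplane. -/
lemma fderiv_sub_neg_of_hessian_pos {Ω : Set W} (hconv : Convex ℝ Ω)
    {ρ : W → ℝ} (hρ : ContDiff ℝ 2 ρ) (hΩ : Ω = {x | ρ x < 0}) (hbd : frontier Ω = {x | ρ x = 0})
    (hhess : ∀ x ∈ frontier Ω, ∀ v, v ≠ 0 → 0 < iteratedFDeriv ℝ 2 ρ x ![v, v]) {x : W}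
    (hx : x ∈ frontier Ω) {z : W} (hz : z ∈ closure Ω) (hzx : z ≠ x) :
    fderiv ℝ ρ x (z - x) < 0 := by
  have hle : ∀ y ∈ closure Ω, ρ y ≤ 0 := by
    refine closure_minimal (fun y hy => ?_) (isClosed_le hρ.continuous continuous_const)
    have h : ρ y < 0 := by simpa [hΩ] using hy
    exact h.le
  have hx0 : ρ x = 0 := by rw [hbd] at hx; exact hx
  have hseg : segment ℝ x z ⊆ closure Ω :=
    hconv.closure.segment_subset (frontier_subset_closure hx) hz
  have hmax : IsLocalMaxOn ρ (closure Ω) x := by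
    filter_upwards [self_mem_nhdsWithin] with y hy
    rw [hx0]; exact hle y hy
  have h1 : fderiv ℝ ρ x (z - x) ≤ 0 := hmax.hasFDerivWithinAt_nonpos
    ((hρ.differentiable (by norm_num)) x).hasFDerivAt.hasFDerivWithinAt
    (sub_mem_posTangentConeAt_of_segment_subset hseg)
  refine h1.lt_of_ne fun h0 => ?_
  have hpos := lt_of_fderiv_eq_zero_of_hessian_pos hρ (hhess x hx _ (sub_ne_zero.2 hzx)) h0
  have hev : ∀ᶠ s in nhdsWithin (0 : ℝ) (Ioi 0), s < 1 :=
    (eventually_lt_nhds one_pos).filter_mono nhdsWithin_le_nhds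
  obtain ⟨s, ⟨hs1, hs2⟩, hs3⟩ := ((hpos.and hev).and self_mem_nhdsWithin).exists
  rw [hx0] at hs1
  refine absurd (hle _ (hseg ?_)) (not_le.2 hs1)
  rw [segment_eq_image']
  exact ⟨s, ⟨le_of_lt hs3, hs2.le⟩, rfl⟩

end Real

section LeviForm

/-- Every inner product on a complex vector space of dimension `n` is isometric to the standard
one. -/
lemma exists_linearEquiv_norm_sq_eq {V : Type*} [AddCommGroup V] [Module ℂ V]
    [FiniteDimensional ℂ V] (c : InnerProductSpace.Core ℂ V) {n : ℕ}
    (hn : Module.finrank ℂ V = n) :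
    ∃ T : V ≃ₗ[ℂ] EuclideanSpace ℂ (Fin n), ∀ z, ‖T z‖ ^ 2 = (c.inner z z).re := by
  let _ : NormedAddCommGroup V := c.toNormedAddCommGroup
  let _ : InnerProductSpace ℂ V := InnerProductSpace.ofCore c.toCore
  let b := (stdOrthonormalBasis ℂ V).reindex (finCongr hn)
  refine ⟨b.repr.toLinearEquiv, fun z => ?_⟩
  have h : ‖b.repr z‖ ^ 2 = ‖z‖ ^ 2 := by rw [b.repr.norm_map]
  refine h.trans ?_
  exact norm_sq_eq_re_inner (𝕜 := ℂ) z

variable {V : Type*} [NormedAddCommGroup V] [NormedSpace ℂ V] [NormedSpace ℝ V]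
  [IsScalarTower ℝ ℂ V]

lemma smul_eq_re_smul_add_im_smul (r : ℂ) (v : V) :
    r • v = r.re • v + r.im • (Complex.I • v) := by
  conv_lhs => rw [← Complex.re_add_im r]
  rw [add_smul, mul_smul, ← Complex.coe_algebraMap, algebraMap_smul, algebraMap_smul]

lemma I_smul_smul_eq (r : ℂ) (v : V) :
    Complex.I • (r • v) = r.re • (Complex.I • v) - r.im • v := by
  rw [smul_comm, smul_eq_re_smul_add_im_smul, smul_smul, Complex.I_mul_I, neg_one_smul, smul_neg,
    sub_eq_add_neg]

/-- The inner product whose real part is the Hermitian part of a positive definite real form. -/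
@[reducible] noncomputable def leviCore (H : V →L[ℝ] V →L[ℝ] ℝ) (hsymm : ∀ v w, H v w = H w v)
    (hpos : ∀ v, v ≠ 0 → 0 < H v v) : InnerProductSpace.Core ℂ V where
  inner x y := ⟨(H x y + H (Complex.I • x) (Complex.I • y)) / 4,
    (H (Complex.I • x) y - H x (Complex.I • y)) / 4⟩
  conj_inner_symm x y := by
    apply Complex.ext
    · simp [hsymm y x, hsymm (Complex.I • y) (Complex.I • x)]
    · simp [hsymm (Complex.I • y) x, hsymm y (Complex.I • x)]
      ring
  re_inner_nonneg x := by
    have h : ∀ v, 0 ≤ H v v := fun v => by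
      rcases eq_or_ne v 0 with rfl | hv
      · simp
      · exact (hpos v hv).le
    have h1 := h x
    have h2 := h (Complex.I • x)
    simp only [RCLike.re_to_complex]
    positivity
  add_left x y z := by
    apply Complex.ext <;> simp <;> ring
  smul_left x y r := by
    rw [I_smul_smul_eq, smul_eq_re_smul_add_im_smul]
    apply Complex.ext <;> simp <;> ring
  definite x hx := by
    by_contra hne
    have h1 := hpos x hne
    have h2 := hpos (Complex.I • x) (smul_ne_zero Complex.I_ne_zero hne)
    have h3 := congrArg Complex.re hx
    simp only [Complex.zero_re] at h3
    linarith

/-- The complex bilinear part of a real bilinear form. -/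
noncomputable def complexBilinearPart (H : V →L[ℝ] V →L[ℝ] ℝ) : V →ₗ[ℂ] V →ₗ[ℂ] ℂ :=
  LinearMap.mk₂ ℂ (fun x y => ⟨(H x y - H (Complex.I • x) (Complex.I • y)) / 4,
      -(H (Complex.I • x) y + H x (Complex.I • y)) / 4⟩)
    (fun x y z => by apply Complex.ext <;> simp <;> ring)
    (fun r x y => by
      rw [I_smul_smul_eq, smul_eq_re_smul_add_im_smul]
      apply Complex.ext <;> simp <;> ring)
    (fun x y z => by apply Complex.ext <;> simp <;> ring)
    (fun r x y => by
      rw [I_smul_smul_eq, smul_eq_re_smul_add_im_smul]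
      apply Complex.ext <;> simp <;> ring)

lemma half_eq_re_complexBilinearPart_add (H : V →L[ℝ] V →L[ℝ] ℝ) (hsymm : ∀ v w, H v w = H w v)
    (hpos : ∀ v, v ≠ 0 → 0 < H v v) (z : V) :
    H z z / 2 = (complexBilinearPart H z z).re + ((leviCore H hsymm hpos).inner z z).re := by
  have h : ((leviCore H hsymm hpos).inner z z).re
      = (H z z + H (Complex.I • z) (Complex.I • z)) / 4 := rfl
  rw [h]
  simp only [complexBilinearPart, LinearMap.mk₂_apply]
  ring

/-- If `Re B(z, z) + ‖z‖²` is positive definite then `|B(z, z)| ≤ a ‖z‖²` for some `a < 1`. -/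
lemma exists_norm_apply_le_of_pos {E : Type*} [NormedAddCommGroup E] [InnerProductSpace ℂ E]
    [ProperSpace E] (B : E →L[ℂ] E →L[ℂ] ℂ)
    (hpos : ∀ z, z ≠ 0 → 0 < (B z z).re + ‖z‖ ^ 2) :
    ∃ a < 1, ∀ z, ‖B z z‖ ≤ a * ‖z‖ ^ 2 := by
  obtain ⟨c, hc, h⟩ : ∃ c > 0, ∀ z ∈ sphere (0 : E) 1, c ≤ (B z z).re + ‖z‖ ^ 2 := by
    rcases (sphere (0 : E) 1).eq_empty_or_nonempty with hempty | hne
    · exact ⟨1, one_pos, fun z hz => by rw [hempty] at hz; exact hz.elim⟩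
    · obtain ⟨z₀, hz₀, hmin⟩ := (isCompact_sphere (0 : E) 1).exists_isMinOn hne
        (f := fun z => (B z z).re + ‖z‖ ^ 2) (by fun_prop)
      refine ⟨_, hpos z₀ (ne_of_mem_sphere hz₀ one_ne_zero), fun z hz => ?_⟩
      exact hmin hz
  have hunit : ∀ z ∈ sphere (0 : E) 1, ‖B z z‖ ≤ 1 - c := by
    intro z hz
    have hzn : ‖z‖ = 1 := mem_sphere_zero_iff_norm.1 hz
    obtain ⟨u, hu⟩ : ∃ u : ℂ, u = Complex.exp (((Real.pi - (B z z).arg) / 2 : ℝ) * Complex.I) :=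
      ⟨_, rfl⟩
    have hun : ‖u‖ = 1 := by rw [hu, Complex.norm_exp_ofReal_mul_I]
    have huw : u * (u * B z z) = -(‖B z z‖ : ℂ) := by
      have h1 : u * u = Complex.exp (Real.pi * Complex.I)
          * Complex.exp (-((B z z).arg * Complex.I)) := by
        rw [hu, ← Complex.exp_add, ← Complex.exp_add]
        congr 1
        push_cast
        ring
      conv_lhs => rw [← Complex.norm_mul_exp_arg_mul_I (B z z)]
      rw [← mul_assoc, h1, Complex.exp_pi_mul_I, Complex.exp_neg]
      have := Complex.exp_ne_zero ((B z z).arg * Complex.I)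
      field_simp
    have h2 := h (u • z) (by simp [norm_smul, hun, hzn])
    rw [norm_smul, hun, hzn] at h2
    simp only [map_smul, _root_.smul_apply, smul_eq_mul] at h2
    rw [huw] at h2
    simp only [Complex.neg_re, Complex.ofReal_re] at h2
    linarith
  refine ⟨1 - c, by linarith, fun z => ?_⟩
  rcases eq_or_ne z 0 with rfl | hz
  · simp
  have hzn : 0 < ‖z‖ := norm_pos_iff.2 hz
  have h1 := hunit ((‖z‖⁻¹ : ℂ) • z) (by
    rw [mem_sphere_zero_iff_norm, norm_smul, norm_inv, Complex.norm_real, norm_norm,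
      inv_mul_cancel₀ hzn.ne'])
  simp only [map_smul, _root_.smul_apply, smul_eq_mul, norm_mul, norm_inv, Complex.norm_real,
    norm_norm] at h1
  rw [← mul_assoc, ← mul_inv, inv_mul_le_iff₀ (by positivity)] at h1
  linarith

/-- A positive definite real quadratic form on a complex vector space is, in suitable linear
coordinates, `z ↦ Re B(z, z) + ‖z‖²` with `B` complex bilinear of size less than one. -/
lemma exists_coordinates_of_posDef [FiniteDimensional ℂ V] {n : ℕ}
    (hn : Module.finrank ℂ V = n) (H : V →L[ℝ] V →L[ℝ] ℝ) (hsymm : ∀ v w, H v w = H w v)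
    (hpos : ∀ v, v ≠ 0 → 0 < H v v) :
    ∃ (S : EuclideanSpace ℂ (Fin n) ≃L[ℂ] V)
      (B : EuclideanSpace ℂ (Fin n) →L[ℂ] EuclideanSpace ℂ (Fin n) →L[ℂ] ℂ),
      (∀ z, H (S z) (S z) / 2 = (B z z).re + ‖z‖ ^ 2) ∧
      ∃ a < 1, ∀ z, ‖B z z‖ ≤ a * ‖z‖ ^ 2 := by
  obtain ⟨T, hT⟩ := exists_linearEquiv_norm_sq_eq (leviCore H hsymm hpos) hn
  let S : EuclideanSpace ℂ (Fin n) ≃L[ℂ] V := T.symm.toContinuousLinearEquiv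
  let B₀ := (complexBilinearPart H).compl₁₂ T.symm.toLinearMap T.symm.toLinearMap
  let B : EuclideanSpace ℂ (Fin n) →L[ℂ] EuclideanSpace ℂ (Fin n) →L[ℂ] ℂ :=
    LinearMap.toContinuousLinearMap (LinearMap.toContinuousLinearMap.toLinearMap ∘ₗ B₀)
  have h1 : ∀ z, H (S z) (S z) / 2 = (B z z).re + ‖z‖ ^ 2 := by
    intro z
    have h2 := hT (S z)
    have h3 : T (S z) = z := T.apply_symm_apply z
    rw [h3] at h2
    rw [h2, half_eq_re_complexBilinearPart_add H hsymm hpos]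
    rfl
  refine ⟨S, B, h1, exists_norm_apply_le_of_pos B fun z hz => ?_⟩
  rw [← h1]
  have := hpos (S z) (S.map_ne_zero_iff.2 hz)
  positivity

end LeviForm

/-- A gradient vector representing a real linear functional on a complex Hilbert space. -/
noncomputable def complexGradient {E : Type*} [NormedAddCommGroup E] [InnerProductSpace ℂ E]
    [CompleteSpace E] [NormedSpace ℝ E] [IsScalarTower ℝ ℂ E] (φ : StrongDual ℝ E) : E :=
  (InnerProductSpace.toDual ℂ E).symm (StrongDual.extendRCLikeₗᵢ φ)

lemma re_inner_complexGradient {E : Type*} [NormedAddCommGroup E] [InnerProductSpace ℂ E]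
    [CompleteSpace E] [NormedSpace ℝ E] [IsScalarTower ℝ ℂ E] (φ : StrongDual ℝ E) (z : E) :
    (inner ℂ (complexGradient φ) z).re = φ z := by
  rw [complexGradient, InnerProductSpace.toDual_symm_apply]
  exact StrongDual.re_extendRCLike_apply (𝕜 := ℂ) φ z

lemma continuous_complexGradient {E : Type*} [NormedAddCommGroup E] [InnerProductSpace ℂ E]
    [CompleteSpace E] [NormedSpace ℝ E] [IsScalarTower ℝ ℂ E] :
    Continuous (complexGradient (E := E)) :=
  (InnerProductSpace.toDual ℂ E).symm.continuous.comp
    (StrongDual.extendRCLikeₗᵢ (𝕜 := ℂ) (F := E)).continuous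

/-- A map of `Ω` with image between two concentric balls bounds the squeezing function below. -/
lemma div_le_squeezingFun {n : ℕ} {Ω : Set (EuclideanSpace ℂ (Fin n))}
    [Nontrivial (EuclideanSpace ℂ (Fin n))] {q : EuclideanSpace ℂ (Fin n)} {r R : ℝ} (hr : 0 < r)
    (hR : 0 < R) {f : EuclideanSpace ℂ (Fin n) → EuclideanSpace ℂ (Fin n)}
    (hf : DifferentiableOn ℂ f Ω) (hinj : InjOn f Ω) (hfR : f '' Ω ⊆ ball 0 R) (hfq : f q = 0)
    (hfr : ball 0 r ⊆ f '' Ω) : r / R ≤ squeezingFun n Ω q := by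
  have hR0 : ((R : ℂ)⁻¹) ≠ 0 := inv_ne_zero (by exact_mod_cast hR.ne')
  refine le_csSup ⟨1, ?_⟩ ⟨by positivity, (R : ℂ)⁻¹ • f, hf.const_smul _, ?_, ?_, ?_, ?_⟩
  · rintro s ⟨hs, g, -, -, hg1, -, hgs⟩
    by_contra! hcon
    obtain ⟨v, hv⟩ := exists_norm_eq (EuclideanSpace ℂ (Fin n)) zero_le_one
    have h1 := hg1 (hgs (show v ∈ ball 0 s by rw [mem_ball_zero_iff, hv]; exact hcon))
    rw [mem_ball_zero_iff, hv] at h1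
    exact lt_irrefl _ h1
  · exact fun w hw w' hw' h => hinj hw hw' (smul_right_injective _ hR0 h)
  · rintro _ ⟨w, hw, rfl⟩
    have h1 := hfR (mem_image_of_mem f hw)
    rw [mem_ball_zero_iff] at h1 ⊢
    rw [Pi.smul_apply, norm_smul, norm_inv, Complex.norm_real, Real.norm_eq_abs, abs_of_pos hR,
      inv_mul_lt_iff₀ hR]
    linarith
  · simp [hfq]
  · intro y hy
    have h1 : (R : ℂ) • y ∈ ball (0 : EuclideanSpace ℂ (Fin n)) r := by
      rw [mem_ball_zero_iff] at hy ⊢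
      rw [norm_smul, Complex.norm_real, Real.norm_eq_abs, abs_of_pos hR, mul_comm]
      exact (lt_div_iff₀ hR).1 hy
    obtain ⟨w, hw, hwy⟩ := hfr h1
    refine ⟨w, hw, ?_⟩
    rw [Pi.smul_apply, hwy, inv_smul_smul₀ (by exact_mod_cast hR.ne')]

end StronglyConvex

/-- If `Ω` is a bounded domain in `ℂⁿ` with `C²` strongly convex
boundary (global defining function `ρ` with nonvanishing gradient and positive definite
real Hessian on `∂Ω`), then `σ_Ω(q) → 1` as `q → p` for every boundary point `p`. -/
theorem squeezing_tendsto_one_strongly_convex (n : ℕ)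
    (Ω : Set (EuclideanSpace ℂ (Fin n)))
    (hopen : IsOpen Ω) (hconn : IsConnected Ω) (hbdd : Bornology.IsBounded Ω)
    (ρ : EuclideanSpace ℂ (Fin n) → ℝ) (hρ : ContDiff ℝ 2 ρ)
    (hΩeq : Ω = {x | ρ x < 0})
    (hbd : frontier Ω = {x | ρ x = 0})
    (hgrad : ∀ x ∈ frontier Ω, fderiv ℝ ρ x ≠ 0)
    (hhess : ∀ x ∈ frontier Ω, ∀ v : EuclideanSpace ℂ (Fin n), v ≠ 0 →
      0 < iteratedFDeriv ℝ 2 ρ x ![v, v]) :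
    ∀ p ∈ frontier Ω, ∀ ε > (0 : ℝ), ∃ r > (0 : ℝ),
      ∀ q ∈ Ω ∩ ball p r, 1 - ε < squeezingFun n Ω q := by
  intro p hp ε hε
  have hconv := convex_of_hessian_pos hopen hconn.isPreconnected hρ hΩeq hbd hhess
  obtain ⟨v, hv⟩ : ∃ v, fderiv ℝ ρ p v ≠ 0 := by
    by_contra! hcon
    exact hgrad p hp (ContinuousLinearMap.ext hcon)
  have : Nontrivial (EuclideanSpace ℂ (Fin n)) :=
    ⟨v, 0, fun h => hv (by rw [h, map_zero])⟩
  obtain ⟨S, B, hSB, a, ha, hB⟩ := exists_coordinates_of_posDef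
    (V := EuclideanSpace ℂ (Fin n)) (n := n) finrank_euclideanSpace_fin
    (fderiv ℝ (fderiv ℝ ρ) p)
    (fun v w => (hρ.contDiffAt.isSymmSndFDerivAt (by simp) : IsSymmSndFDerivAt ℝ ρ p) v w)
    (fun v hv => by
      have := hhess p hp v hv
      rw [iteratedFDeriv_two_apply] at this
      simpa using this)
  let Sr : EuclideanSpace ℂ (Fin n) →L[ℝ] EuclideanSpace ℂ (Fin n) :=
    (S : EuclideanSpace ℂ (Fin n) →L[ℂ] EuclideanSpace ℂ (Fin n)).restrictScalars ℝ
  let G : EuclideanSpace ℂ (Fin n) → EuclideanSpace ℂ (Fin n) :=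
    fun x => complexGradient ((fderiv ℝ ρ (S x)).comp Sr)
  have hG : ∀ x z, (inner ℂ (G x) z).re = fderiv ℝ ρ (S x) (S z) := fun x z =>
    re_inner_complexGradient _ _
  have hGc : Continuous G := by
    refine continuous_complexGradient.comp ?_
    exact ((hρ.continuous_fderiv (by norm_num)).comp S.continuous).clm_comp continuous_const
  have hfront : frontier (S ⁻¹' Ω) = S ⁻¹' frontier Ω :=
    (S.toHomeomorph.preimage_frontier Ω).symm
  have hclos : closure (S ⁻¹' Ω) = S ⁻¹' closure Ω :=
    (S.toHomeomorph.preimage_closure Ω).symm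
  have hneg : ∀ x ∈ frontier (S ⁻¹' Ω), ∀ z ∈ closure (S ⁻¹' Ω), z ≠ x →
      (inner ℂ (G x) (z - x)).re < 0 := by
    intro x hx z hz hzx
    rw [hfront] at hx
    rw [hclos] at hz
    rw [hG, map_sub]
    exact fderiv_sub_neg_of_hessian_pos hconv hρ hΩeq hbd hhess hx hz (S.injective.ne hzx)
  have hpS : S.symm p ∈ frontier (S ⁻¹' Ω) := by
    rw [hfront]
    simpa using hp
  obtain ⟨ε', hε'0, hε'1, hε'2⟩ : ∃ ε' > 0, ε' ≤ 1 / 2 ∧ 2 * ε' ≤ ε :=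
    ⟨min (1 / 2) (ε / 2), by positivity, min_le_left _ _, by
      linarith [min_le_right (1 / 2) (ε / 2)]⟩
  obtain ⟨r, hr, h⟩ := exists_almost_ball_map (Ω := S ⁻¹' Ω) (σ := fun x => ρ (S x))
    (p := S.symm p) (G := G) (B := B) (ε := ε') (hopen.preimage S.continuous)
    (by
      have := S.symm.lipschitz.isBounded_image hbdd
      rwa [ContinuousLinearEquiv.image_symm_eq_preimage] at this)
    (by ext x; simp [hΩeq])
    (fun x hx => by
      rw [hfront, hbd] at hx
      exact hx)
    hpS hGc.continuousAt
    (fun h0 => hv (by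
      have := hG (S.symm p) (S.symm v)
      rw [h0] at this
      simpa using this.symm))
    (fun x hx z hz => by
      rcases eq_or_ne z x with rfl | hzx
      · simp
      · exact (hneg x hx z (subset_closure hz) hzx).le)
    (hneg _ hpS)
    (fun η hη => by
      obtain ⟨M, hM, hMS⟩ : ∃ M > 0, ∀ z, ‖S z‖ ≤ M * ‖z‖ :=
        (S : EuclideanSpace ℂ (Fin n) →L[ℂ] EuclideanSpace ℂ (Fin n)).bound
      obtain ⟨r, hr, h⟩ := exists_uniform_taylor hρ p (η := η / M ^ 2) (by positivity)
      refine ⟨r / M, by positivity, fun x hx z hz => ?_⟩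
      have h1 := h (S x) (by
        rw [mem_ball, dist_eq_norm] at hx ⊢
        have h2 : S x - p = S (x - S.symm p) := by simp
        rw [h2]
        refine (hMS _).trans_lt ?_
        rw [mul_comm]
        exact (lt_div_iff₀ hM).1 hx) (S z) ((hMS z).trans (by
          rw [mul_comm]
          exact (le_div_iff₀ hM).1 hz))
      rw [hSB] at h1
      rw [map_add, hG]
      refine h1.trans ?_
      rw [div_mul_eq_mul_div, div_le_iff₀ (by positivity), mul_assoc, ← mul_pow, mul_comm _ M]
      gcongr
      exact hMS z)
    ha hB hε'0 (by linarith)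
  obtain ⟨r', hr', hball⟩ := Metric.continuousAt_iff.1 S.symm.continuous.continuousAt r hr
  refine ⟨r', hr', fun q hq => ?_⟩
  obtain ⟨f, hf, hinj, hfR, hfq, hfr⟩ := h (S.symm q)
    ⟨by simpa using hq.1, hball hq.2⟩
  have hmaps : MapsTo S.symm Ω (S ⁻¹' Ω) := fun w hw => by simpa using hw
  have himage : (fun w => f (S.symm w)) '' Ω = f '' (S ⁻¹' Ω) := by
    rw [← ContinuousLinearEquiv.image_symm_eq_preimage, image_image]
  refine lt_of_lt_of_le ?_ (div_le_squeezingFun (q := q) (f := fun w => f (S.symm w))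
    (r := 1 - ε') (R := 1 + ε') (by linarith) (by linarith)
    (hf.comp S.symm.differentiable.differentiableOn hmaps)
    (hinj.comp S.symm.injective.injOn hmaps) (by rwa [himage]) hfq (by rwa [himage]))
  rw [lt_div_iff₀ (by linarith)]
  nlinarith
end
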